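/- arXiv:math/0203203 — 3 statements merged into one kernel-verified Lean document; each statement's English description precedes it below -/
import Mathlib

section
/- Let A ⊆ ℝP^n be an L-convex-concave set, where L ⊆ ℝP^n is a projective subspace. Then the L-dual set A^⊥_L is an L*-convex-concave subset of (ℝP^n)*, and the duality relation (A^⊥_L)^⊥_{L*} = A holds (identifying ((ℝP^n)*)* with ℝP^n). -/
open Module Set Pointwise

noncomputable section

namespace CC

/-- The underlying vector space of `ℝPⁿ`. -/
abbrev Vec (n : ℕ) : Type := Fin (n + 1) → ℝ

/-- Real projective `n`-space `ℝPⁿ = ℙ(ℝ^{n+1})`. -/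
abbrev Pt (n : ℕ) : Type := Projectivization ℝ (Vec n)

/-- The dual projective space `(ℝPⁿ)*`, whose points are the hyperplanes of `ℝPⁿ`. -/
abbrev DPt (n : ℕ) : Type := Projectivization ℝ (Module.Dual ℝ (Vec n))

/-- The quotient topology on a projectivization. -/
instance projTop {K V : Type*} [DivisionRing K] [AddCommGroup V] [Module K V]
    [TopologicalSpace V] : TopologicalSpace (Projectivization K V) :=
  instTopologicalSpaceQuotient

/-- The canonical topology on the dual of `ℝ^{n+1}` (transported through any linear
coordinate system; all bases induce the same topology). -/
instance dualTop (n : ℕ) : TopologicalSpace (Module.Dual ℝ (Vec n)) :=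
  TopologicalSpace.induced (Module.finBasis ℝ (Module.Dual ℝ (Vec n))).equivFun inferInstance

variable {M : Type*} [AddCommGroup M] [Module ℝ M]

/-- The point `x ∈ ℙ(M)` lies on the hyperplane corresponding to the point `π` of the
dual projective space `ℙ(M*)` (i.e. `x` is in the projectivization of the kernel of any
functional representing `π`). -/
def Incident (π : Projectivization ℝ (Module.Dual ℝ M)) (x : Projectivization ℝ M) : Prop :=
  π.rep x.rep = 0

/-- The projectively dual set `S*_p ⊆ P*`: the set of all hyperplanes of `P`
disjoint from `S`. -/
def dualSet (A : Set (Projectivization ℝ M)) : Set (Projectivization ℝ (Module.Dual ℝ M)) :=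
  {π | ∀ x ∈ A, ¬Incident π x}

/-- Projective separability: every point of the complement of `S` lies on a hyperplane
disjoint from `S`. -/
def ProjSeparable (A : Set (Projectivization ℝ M)) : Prop :=
  ∀ x ∉ A, ∃ π : Projectivization ℝ (Module.Dual ℝ M), Incident π x ∧ ∀ y ∈ A, ¬Incident π y

/-- The projective subspace of `ℙ(M)` associated to a linear subspace `W ≤ M`. -/
def projSet (W : Submodule ℝ M) : Set (Projectivization ℝ M) :=
  {x | x.rep ∈ W}

/-- The canonical identification `ℙ(M) → ℙ(M**)` induced by the canonical isomorphism
`M ≃ M**`. -/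
def toDoubleDual [FiniteDimensional ℝ M] :
    Projectivization ℝ M → Projectivization ℝ (Module.Dual ℝ (Module.Dual ℝ M)) :=
  Projectivization.map (Module.evalEquiv ℝ M).toLinearMap (Module.evalEquiv ℝ M).injective

/-- The `L`-dual set `A^⊥_L ⊆ ℙ(M*)` of a set `A ⊆ ℙ(M)` (for `L = ℙ(W)`): the set of
all hyperplanes `π` of `ℙ(M)` meeting every section `A ∩ N` by a projective subspace
`N ⊇ L` with `dim N = dim L + 1`. -/
def LdualSet (W : Submodule ℝ M) (A : Set (Projectivization ℝ M)) :
    Set (Projectivization ℝ (Module.Dual ℝ M)) :=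
  {π | ∀ N : Submodule ℝ M, W ≤ N → finrank ℝ N = finrank ℝ W + 1 →
    ∃ x ∈ A, Incident π x ∧ x.rep ∈ N}

/-- `(A^⊥_L)^⊥_{L*}`, brought back from `ℙ(M**)` to `ℙ(M)` via the canonical
identification `M ≅ M**`. -/
def Lbidual [FiniteDimensional ℝ M] (W : Submodule ℝ M) (A : Set (Projectivization ℝ M)) :
    Set (Projectivization ℝ M) :=
  toDoubleDual ⁻¹' LdualSet W.dualAnnihilator (LdualSet W A)

/-- The image of a set `A ⊆ ℙ(M)` under the projection from the center `ℙ(W)`: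
`y` is in the image iff some point `x ∈ A` not in the center projects to `y`
(i.e. the class of a representing vector of `x` spans the line `y`). -/
def projImage (W : Submodule ℝ M) (A : Set (Projectivization ℝ M)) :
    Set (Projectivization ℝ (M ⧸ W)) :=
  {y | ∃ x ∈ A, x.rep ∉ W ∧ W.mkQ x.rep ∈ y.submodule}

/-- The coordinate, in the affine chart of `ℙ(M)` given by a functional `φ`
(the complement of the hyperplane `ℙ(ker φ)`, identified with `{v | φ v = 1}`),
of a point `x` with `φ x.rep ≠ 0`. -/
def projChart (φ : Module.Dual ℝ M) (x : Projectivization ℝ M) : M :=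
  (φ x.rep)⁻¹ • x.rep

/-- A convex subset of a projective space: a set disjoint from some hyperplane and
convex in the corresponding affine chart. -/
def IsProjConvex (A : Set (Projectivization ℝ M)) : Prop :=
  ∃ φ : Module.Dual ℝ M, φ ≠ 0 ∧ (∀ x ∈ A, φ x.rep ≠ 0) ∧ Convex ℝ (projChart φ '' A)

/-- `L`-convex-concavity of a closed set `A ⊆ ℙ(M)` with respect to the projective
subspace `L = ℙ(W)`: `A` is closed, disjoint from `L`, all sections of `A` by
projective subspaces `N ⊇ L` with `dim N = dim L + 1` are nonempty and convex, and the
complement of the projection of `A` from any center `T ⊂ L` with `dim T = dim L − 1`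
is open and convex. -/
def IsLConvexConcave [TopologicalSpace M] (W : Submodule ℝ M)
    (A : Set (Projectivization ℝ M)) : Prop :=
  IsClosed A ∧ (∀ x ∈ A, x.rep ∉ W) ∧
    (∀ N : Submodule ℝ M, W ≤ N → finrank ℝ N = finrank ℝ W + 1 →
      (A ∩ projSet N).Nonempty ∧ IsProjConvex (A ∩ projSet N)) ∧
    (∀ T : Submodule ℝ M, T ≤ W → finrank ℝ T + 1 = finrank ℝ W →
      IsOpen (projImage T A)ᶜ ∧ IsProjConvex (projImage T A)ᶜ)

/-- The lift of a hyperplane `π` of `ℙ(M)` containing the center `ℙ(Q)` to a hyperplane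
of the quotient projective space `ℙ(M ⧸ Q)`. -/
def liftHyperplane (Q : Submodule ℝ M) (π : Projectivization ℝ (Module.Dual ℝ M))
    (h : ∀ v ∈ Q, π.rep v = 0) : Projectivization ℝ (Module.Dual ℝ (M ⧸ Q)) :=
  Projectivization.mk ℝ (Q.liftQ π.rep fun v hv => LinearMap.mem_ker.mpr (h v hv))
    (fun hz => π.rep_nonzero (by
      have h2 := Submodule.liftQ_mkQ Q π.rep (fun v hv => LinearMap.mem_ker.mpr (h v hv))
      rw [hz] at h2
      simpa using h2.symm))

/-- Affine separability of a set `B`, inside the affine chart of `ℙ(M)` given by a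
functional `φ`: every point of the chart outside `B` lies in a closed half-space of the
chart (cut out by an affine function which is nonconstant on the chart) disjoint
from `B`.  A closed half-space of the chart `{v | φ v = 1}` is cut out by a functional
`g` (nonproportional to `φ`, so that `g` is nonconstant on the chart) via the
scale-invariant condition `g(x)/φ(x) ≥ 0`. -/
def AffSepInChart (φ : Module.Dual ℝ M) (B : Set (Projectivization ℝ M)) : Prop :=
  ∀ y : Projectivization ℝ M, φ y.rep ≠ 0 → y ∉ B →
    ∃ g : Module.Dual ℝ M, (∀ c : ℝ, g ≠ c • φ) ∧ 0 ≤ g y.rep / φ y.rep ∧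
      ∀ z ∈ B, g z.rep / φ z.rep < 0

/-- `A` is coseparable relative to `L = ℙ(W)`: `A` is disjoint from `L`, and for every
hyperplane `L₁` of `L`, the complement of the projection of `A` from the center `L₁`
misses some hyperplane of `ℝPⁿ/L₁` and is affinely separable in the corresponding
affine chart. -/
def Coseparable (W : Submodule ℝ M) (A : Set (Projectivization ℝ M)) : Prop :=
  (∀ x ∈ A, x.rep ∉ W) ∧
    ∀ W₁ : Submodule ℝ M, W₁ ≤ W → finrank ℝ W₁ + 1 = finrank ℝ W →
      ∃ φ : Module.Dual ℝ (M ⧸ W₁), φ ≠ 0 ∧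
        (∀ y ∈ (projImage W₁ A)ᶜ, φ y.rep ≠ 0) ∧
        AffSepInChart φ (projImage W₁ A)ᶜ

/-- A set `S` contained in the projective subspace `N = ℙ(Nsub)`, disjoint from the
hyperplane `L = ℙ(W)` of `N`, is pointed with respect to `Δ ⊆ L` if it has two vertices
`a, b ∈ S` such that a hyperplane `p` of `N` disjoint from `Δ` meets `S` iff it meets
the straight segment joining `a` and `b` in the affine chart `N ∖ L` (the chart being
given by any functional vanishing on `W` and nonzero at `a` and `b`). -/
def PointedWrt (W Nsub : Submodule ℝ M) (Δ S : Set (Projectivization ℝ M)) : Prop :=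
  ∃ a ∈ S, ∃ b ∈ S,
    ∀ P : Submodule ℝ M, P ≤ Nsub → finrank ℝ P + 1 = finrank ℝ Nsub →
      (∀ x ∈ Δ, x.rep ∉ P) →
      ((∃ x ∈ S, x.rep ∈ P) ↔
        ∀ φ : Module.Dual ℝ M, (∀ w ∈ W, φ w = 0) → φ a.rep ≠ 0 → φ b.rep ≠ 0 →
          ∃ t ∈ Icc (0 : ℝ) 1,
            t • ((φ a.rep)⁻¹ • a.rep) + (1 - t) • ((φ b.rep)⁻¹ • b.rep) ∈ P)

/-- The hyperplane `Γ_c` of `ℙ(M)` containing the center `ℙ(W)` and corresponding to the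
point `c` of `ℙ(M ⧸ W)`. -/
def gammaSet (W : Submodule ℝ M) (c : Projectivization ℝ (M ⧸ W)) :
    Set (Projectivization ℝ M) :=
  {x | W.mkQ x.rep ∈ c.submodule}

/-- The surgery `S_{[a,b]}(A)` of a set `A ⊆ ℙ(M)` along the arc `Arc = [a,b]` of the
projective line `ℙ(M ⧸ W)`, computed in the affine chart given by a functional `φ`
whose kernel is the cone of the hyperplane `Γ_c` (for a point `c ∉ Arc`): points
projecting into `Arc` are replaced by the convex hull of `(A ∩ Γ_a) ∪ (A ∩ Γ_b)` taken
in the chart, points projecting outside `Arc` are kept iff they belong to `A`, and the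
result is disjoint from `ℙ(W)`. -/
def surgery (W : Submodule ℝ M) (a b : Projectivization ℝ (M ⧸ W))
    (Arc : Set (Projectivization ℝ (M ⧸ W))) (φ : Module.Dual ℝ M)
    (A : Set (Projectivization ℝ M)) : Set (Projectivization ℝ M) :=
  {x | x.rep ∉ W ∧
    ((∃ y ∈ Arc, W.mkQ x.rep ∈ y.submodule) →
      φ x.rep ≠ 0 ∧
        projChart φ x ∈ convexHull ℝ (projChart φ '' (A ∩ (gammaSet W a ∪ gammaSet W b)))) ∧
    ((¬∃ y ∈ Arc, W.mkQ x.rep ∈ y.submodule) → x ∈ A)}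

/-- The linear map `M* ⧸ T → Q*` (for `Q = ℙ(T)*`-perp, i.e. `Q = T.dualCoannihilator`)
realizing the canonical identification of `(ℝPⁿ)*/T` with the space of hyperplanes of
the projective space `ℙ(Q)`: the class of a hyperplane `π ⊅ Q` of `ℝPⁿ` corresponds to
the hyperplane `π ∩ ℙ(Q)` of `ℙ(Q)`. -/
def restrictToSub (T : Submodule ℝ (Module.Dual ℝ M)) :
    (Module.Dual ℝ M ⧸ T) →ₗ[ℝ] Module.Dual ℝ T.dualCoannihilator :=
  T.liftQ (T.dualCoannihilator.subtype.dualMap)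
    (fun φ hφ => LinearMap.mem_ker.mpr
      (LinearMap.ext fun q => (Submodule.mem_dualCoannihilator _).mp q.2 φ hφ))


/-! ### Cones over subsets of projective spaces -/

/-- The set of nonzero vectors representing points of `A`. -/
def coneOf {V : Type*} [AddCommGroup V] [Module ℝ V] (A : Set (Projectivization ℝ V)) : Set V :=
  {v | ∃ hv : v ≠ 0, Projectivization.mk ℝ v hv ∈ A}

section Cones

variable {V : Type*} [AddCommGroup V] [Module ℝ V]

theorem coneOf_mk {A : Set (Projectivization ℝ V)} {v : V} (hv : v ≠ 0) :
    v ∈ coneOf A ↔ Projectivization.mk ℝ v hv ∈ A :=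
  ⟨fun ⟨_, h⟩ => h, fun h => ⟨hv, h⟩⟩

theorem coneOf_ne {A : Set (Projectivization ℝ V)} {v : V} (hv : v ∈ coneOf A) : v ≠ 0 := hv.1

theorem coneOf_rep {A : Set (Projectivization ℝ V)} {x : Projectivization ℝ V} :
    x.rep ∈ coneOf A ↔ x ∈ A := by
  rw [coneOf_mk x.rep_nonzero, Projectivization.mk_rep]

theorem mk_smul_eq {v : V} {c : ℝ} (hc : c ≠ 0) (hv : v ≠ 0) (hcv : c • v ≠ 0) :
    Projectivization.mk ℝ (c • v) hcv = Projectivization.mk ℝ v hv :=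
  (Projectivization.mk_eq_mk_iff' ℝ _ _ _ _).2 ⟨c, rfl⟩

theorem coneOf_smul {A : Set (Projectivization ℝ V)} {v : V} {c : ℝ} (hc : c ≠ 0) :
    c • v ∈ coneOf A ↔ v ∈ coneOf A := by
  by_cases hv : v = 0
  · simp [hv]
  · have hcv : c • v ≠ 0 := smul_ne_zero hc hv
    rw [coneOf_mk hv, coneOf_mk hcv, mk_smul_eq hc hv]

theorem coneOf_neg {A : Set (Projectivization ℝ V)} {v : V} :
    -v ∈ coneOf A ↔ v ∈ coneOf A := by
  simpa using coneOf_smul (A := A) (v := v) (c := -1) (by norm_num)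

theorem rep_eq {v : V} (hv : v ≠ 0) :
    ∃ c : ℝ, c ≠ 0 ∧ (Projectivization.mk ℝ v hv).rep = c • v := by
  obtain ⟨a, ha⟩ := Projectivization.exists_smul_eq_mk_rep ℝ v hv
  exact ⟨a, a.ne_zero, ha.symm⟩

theorem coneOf_compl {A : Set (Projectivization ℝ V)} {v : V} :
    v ∈ coneOf Aᶜ ↔ v ≠ 0 ∧ v ∉ coneOf A := by
  constructor
  · rintro ⟨hv, h⟩
    exact ⟨hv, fun h' => h ((coneOf_mk hv).1 h')⟩
  · rintro ⟨hv, h⟩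
    exact ⟨hv, fun h' => h ((coneOf_mk hv).2 h')⟩

theorem coneOf_inter_projSet {A : Set (Projectivization ℝ V)} {N : Submodule ℝ V} {v : V} :
    v ∈ coneOf (A ∩ projSet N) ↔ v ∈ coneOf A ∧ v ∈ N := by
  have key : ∀ hv : v ≠ 0, (Projectivization.mk ℝ v hv ∈ projSet N ↔ v ∈ N) := by
    intro hv
    obtain ⟨c, hc, h⟩ := rep_eq hv
    simp only [projSet, mem_ofPred_eq, h]
    exact N.smul_mem_iff hc
  constructor
  · rintro ⟨hv, h1, h2⟩
    exact ⟨⟨hv, h1⟩, (key hv).1 h2⟩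
  · rintro ⟨⟨hv, h1⟩, h2⟩
    exact ⟨hv, h1, (key hv).2 h2⟩

theorem chart_image {S : Set (Projectivization ℝ V)} {φ : Module.Dual ℝ V}
    (hφ : ∀ x ∈ S, φ x.rep ≠ 0) :
    projChart φ '' S = {v | φ v = 1 ∧ v ∈ coneOf S} := by
  ext v
  constructor
  · rintro ⟨x, hx, rfl⟩
    refine ⟨?_, ?_⟩
    · simp [projChart, inv_mul_cancel₀ (hφ x hx)]
    · exact (coneOf_smul (inv_ne_zero (hφ x hx))).2 (coneOf_rep.2 hx)
  · rintro ⟨h1, hv, h2⟩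
    refine ⟨_, h2, ?_⟩
    obtain ⟨c, hc, h⟩ := rep_eq hv
    simp [projChart, h, h1, smul_smul, inv_mul_cancel₀ hc]

theorem isProjConvex_of {S : Set (Projectivization ℝ V)} (φ : Module.Dual ℝ V) (h0 : φ ≠ 0)
    (hφ : ∀ v ∈ coneOf S, φ v ≠ 0) (hc : Convex ℝ {v | φ v = 1 ∧ v ∈ coneOf S}) :
    IsProjConvex S := by
  have h' : ∀ x ∈ S, φ x.rep ≠ 0 := fun x hx => hφ _ (coneOf_rep.2 hx)
  refine ⟨φ, h0, h', ?_⟩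
  rw [chart_image h']
  exact hc

theorem isProjConvex_to {S : Set (Projectivization ℝ V)} (h : IsProjConvex S) :
    ∃ φ : Module.Dual ℝ V, (∀ v ∈ coneOf S, φ v ≠ 0) ∧
      ∀ a ∈ coneOf S, ∀ b ∈ coneOf S, 0 < φ a * φ b → a + b ∈ coneOf S := by
  obtain ⟨φ, -, h1, h2⟩ := h
  rw [chart_image h1] at h2
  have h3 : ∀ v ∈ coneOf S, φ v ≠ 0 := by
    rintro v ⟨hv, hS⟩ h0
    obtain ⟨c, hc, h⟩ := rep_eq hv
    exact h1 _ hS (by rw [h]; simp [h0])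
  refine ⟨φ, h3, ?_⟩
  intro a ha b hb hab
  have ha0 := h3 a ha
  have hb0 := h3 b hb
  have hs : φ a + φ b ≠ 0 := by
    intro hs
    have : φ b = - φ a := by linarith
    rw [this] at hab
    nlinarith [sq_nonneg (φ a)]
  have hw : ∀ x y : ℝ, 0 < x * y → 0 ≤ x / (x + y) := by
    intro x y hxy
    have : x / (x + y) = (x * x + x * y) / ((x + y) * (x + y)) := by
      by_cases h : x + y = 0
      · simp [h]
      · field_simp
    rw [this]
    have := mul_self_nonneg x
    have := mul_self_nonneg (x + y)
    positivity
  have hm := h2 (x := (φ a)⁻¹ • a) ⟨by simp [ha0], (coneOf_smul (inv_ne_zero ha0)).2 ha⟩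
    (y := (φ b)⁻¹ • b) ⟨by simp [hb0], (coneOf_smul (inv_ne_zero hb0)).2 hb⟩
    (a := φ a / (φ a + φ b)) (b := φ b / (φ a + φ b)) (hw _ _ hab)
    (by rw [add_comm (φ a)]; exact hw _ _ (by rwa [mul_comm])) (by field_simp)
  have heq : (φ a / (φ a + φ b)) • (φ a)⁻¹ • a + (φ b / (φ a + φ b)) • (φ b)⁻¹ • b
      = (φ a + φ b)⁻¹ • (a + b) := by
    rw [smul_smul, smul_smul, smul_add]
    congr 2 <;> field_simp
  rw [heq] at hm
  exact (coneOf_smul (inv_ne_zero hs)).1 hm.2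

theorem isOpen_iff_cone [TopologicalSpace V] {S : Set (Projectivization ℝ V)} :
    IsOpen S ↔ ∃ U : Set V, IsOpen U ∧ ∀ v, v ≠ 0 → (v ∈ U ↔ v ∈ coneOf S) := by
  have h1 : IsOpen S ↔ IsOpen ((Projectivization.mk' ℝ : {v : V // v ≠ 0} → _) ⁻¹' S) := Iff.rfl
  rw [h1, isOpen_induced_iff]
  constructor
  · rintro ⟨U, hU, h⟩
    refine ⟨U, hU, fun v hv => ?_⟩
    have := Set.ext_iff.1 h ⟨v, hv⟩
    rw [coneOf_mk hv]
    exact this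
  · rintro ⟨U, hU, h⟩
    refine ⟨U, hU, ?_⟩
    ext ⟨v, hv⟩
    have := h v hv
    rw [coneOf_mk hv] at this
    exact this

theorem mem_cone_projImage {A : Set (Projectivization ℝ V)} {T : Submodule ℝ V}
    (hT : ∀ v ∈ coneOf A, v ∉ T) (u : V) :
    T.mkQ u ∈ coneOf (projImage T A)ᶜ ↔ u ∉ T ∧ ∀ v ∈ coneOf A, v - u ∉ T := by
  have h0 : T.mkQ u ≠ 0 ↔ u ∉ T := by simp
  rw [coneOf_compl, h0]
  refine and_congr_right fun hu => ?_
  have hu0 := h0.2 hu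
  rw [coneOf_mk hu0]
  constructor
  · intro h v hv hvu
    apply h
    obtain ⟨c, hc, hr⟩ := rep_eq (coneOf_ne hv)
    refine ⟨_, (coneOf_mk (coneOf_ne hv)).1 hv, ?_, ?_⟩
    · rw [hr, T.smul_mem_iff hc]
      exact hT v hv
    · rw [hr, Projectivization.submodule_mk, Submodule.mem_span_singleton]
      refine ⟨c, ?_⟩
      rw [map_smul]
      congr 1
      rw [← sub_eq_zero, ← map_sub]
      simp only [Submodule.mkQ_apply, Submodule.Quotient.mk_eq_zero]
      simpa using T.neg_mem hvu
  · rintro h ⟨x, hx, hxT, hm⟩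
    rw [Projectivization.submodule_mk, Submodule.mem_span_singleton] at hm
    obtain ⟨c, hc⟩ := hm
    rw [← map_smul, ← sub_eq_zero, ← map_sub] at hc
    simp only [Submodule.mkQ_apply, Submodule.Quotient.mk_eq_zero] at hc
    have hc0 : c ≠ 0 := by
      rintro rfl
      apply hxT
      simpa using hc
    refine h (c⁻¹ • x.rep) ((coneOf_smul (inv_ne_zero hc0)).2 (coneOf_rep.2 hx)) ?_
    have := T.smul_mem (-c⁻¹) hc
    convert this using 1
    rw [smul_sub, smul_smul]
    have : -c⁻¹ * c = -1 := by field_simp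
    rw [this]
    module

theorem finrank_sup_span [FiniteDimensional ℝ V] (P : Submodule ℝ V) {v : V} (hv : v ∉ P) :
    finrank ℝ ↥(P ⊔ Submodule.span ℝ {v}) = finrank ℝ P + 1 := by
  apply le_antisymm
  · have h1 := Submodule.finrank_add_le_finrank_add_finrank P (Submodule.span ℝ {v})
    have h2 := finrank_span_singleton (K := ℝ) (v := v) (fun h => hv (h ▸ P.zero_mem))
    omega
  · refine Submodule.finrank_lt_finrank_of_lt (lt_of_le_of_ne le_sup_left fun h => hv ?_)
    rw [h]
    exact Submodule.mem_sup_right (Submodule.mem_span_singleton_self v)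

theorem eq_sup_span [FiniteDimensional ℝ V] {P Q : Submodule ℝ V} (h : P ≤ Q)
    (hr : finrank ℝ Q = finrank ℝ P + 1) :
    ∃ v ∈ Q, v ∉ P ∧ Q = P ⊔ Submodule.span ℝ {v} := by
  have hlt : ¬ Q ≤ P := fun h' => by
    have := le_antisymm h h'
    subst this
    omega
  obtain ⟨v, hvQ, hvP⟩ := SetLike.not_le_iff_exists.1 hlt
  refine ⟨v, hvQ, hvP, ?_⟩
  symm
  apply Submodule.eq_of_le_of_finrank_le
  · exact sup_le h (by simpa using hvQ)
  · rw [finrank_sup_span P hvP, hr]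

theorem mem_sup_span {P : Submodule ℝ V} {v x : V} :
    x ∈ P ⊔ Submodule.span ℝ {v} ↔ ∃ s : ℝ, x - s • v ∈ P := by
  rw [Submodule.mem_sup]
  constructor
  · rintro ⟨p, hp, z, hz, rfl⟩
    obtain ⟨s, rfl⟩ := Submodule.mem_span_singleton.1 hz
    exact ⟨s, by simpa using hp⟩
  · rintro ⟨s, hs⟩
    exact ⟨_, hs, s • v, Submodule.smul_mem _ _ (Submodule.mem_span_singleton_self v), by simp⟩

end Cones

/-! ### Sublinear functions and Hahn-Banach -/

theorem hb {E : Type*} [AddCommGroup E] [Module ℝ E] (g : E → ℝ)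
    (g_hom : ∀ c : ℝ, 0 < c → ∀ x, g (c • x) = c * g x) (g_add : ∀ x y, g (x + y) ≤ g x + g y)
    (a : E) (t : ℝ) (h1 : t ≤ g a) (h2 : -t ≤ g (-a)) :
    ∃ F : Module.Dual ℝ E, F a = t ∧ ∀ x, F x ≤ g x := by
  have g0 : g 0 = 0 := by
    have := g_hom 2 (by norm_num) 0
    rw [smul_zero] at this
    linarith
  have H : ∀ c : ℝ, c • a = 0 → (RingHom.id ℝ) c • t = 0 := by
    intro c hc
    rcases smul_eq_zero.1 hc with h | h
    · simp [h]
    · subst h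
      rw [neg_zero] at h2
      have : t = 0 := by linarith
      simp [this]
  obtain ⟨F, hF1, hF2⟩ := exists_extension_of_le_sublinear
    (LinearPMap.mkSpanSingleton' a t H) g g_hom g_add (by
      rintro ⟨x, hx⟩
      obtain ⟨c, rfl⟩ := Submodule.mem_span_singleton.1 hx
      rw [LinearPMap.mkSpanSingleton'_apply]
      simp only [RingHom.id_apply, smul_eq_mul]
      rcases lt_trichotomy c 0 with h | h | h
      · have : g (c • a) = (-c) * g (-a) := by
          rw [← g_hom _ (by linarith)]; simp
        rw [this]
        nlinarith
      · simp [h, g0]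
      · rw [g_hom c h]
        nlinarith)
  refine ⟨F, ?_, hF2⟩
  have ha : a ∈ (LinearPMap.mkSpanSingleton' a t H).domain := Submodule.mem_span_singleton_self a
  have := hF1 ⟨a, ha⟩
  rw [LinearPMap.mkSpanSingleton'_apply_self] at this
  exact this

theorem continuous_sublinear {V : Type*} [AddCommGroup V] [Module ℝ V] [TopologicalSpace V]
    [IsTopologicalAddGroup V] [ContinuousSMul ℝ V] [T2Space V] [FiniteDimensional ℝ V]
    (g : V → ℝ) (g_hom : ∀ c : ℝ, 0 < c → ∀ x, g (c • x) = c * g x)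
    (g_add : ∀ x y, g (x + y) ≤ g x + g y) : Continuous g := by
  let b := (Module.finBasis ℝ V).equivFun
  have hb1 : Continuous b := LinearMap.continuous_of_finiteDimensional b.toLinearMap
  have g0 : g 0 = 0 := by
    have := g_hom 2 (by norm_num) 0
    rw [smul_zero] at this
    linarith
  have hconv : ConvexOn ℝ Set.univ (fun z => g (b.symm z)) := by
    have gh : ∀ c : ℝ, 0 ≤ c → ∀ x, g (c • x) = c * g x := by
      intro c hc x
      rcases hc.eq_or_lt with h | h
      · simp [← h, g0]
      · exact g_hom c h x
    refine ⟨convex_univ, ?_⟩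
    intro x _ y _ a c ha hc _
    simp only [map_add, map_smul, smul_eq_mul]
    refine (g_add _ _).trans ?_
    rw [gh a ha, gh c hc]
  have hc := (hconv.locallyLipschitz).continuous.comp hb1
  have : (fun z => g (b.symm z)) ∘ b = g := by
    ext x; simp
  rwa [this] at hc

/-! ### Bisublinear functions -/

/-- Functions that are sublinear in each variable, with the symmetry `h(-y,ψ) = h(y,-ψ)`. -/
structure Bisub {X Y : Type*} [AddCommGroup X] [Module ℝ X] [AddCommGroup Y] [Module ℝ Y]
    (h : Y → Module.Dual ℝ X → ℝ) : Prop where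
  hl : ∀ c : ℝ, 0 < c → ∀ y ψ, h (c • y) ψ = c * h y ψ
  hr : ∀ c : ℝ, 0 < c → ∀ y ψ, h y (c • ψ) = c * h y ψ
  al : ∀ y z ψ, h (y + z) ψ ≤ h y ψ + h z ψ
  ar : ∀ y ψ χ, h y (ψ + χ) ≤ h y ψ + h y χ
  neg : ∀ y ψ, h (-y) ψ = h y (-ψ)

section Main

variable {V X Y : Type*} [AddCommGroup V] [Module ℝ V] [AddCommGroup X] [Module ℝ X]
  [AddCommGroup Y] [Module ℝ Y]

theorem Bisub.zl {h : Y → Module.Dual ℝ X → ℝ} (hb : Bisub h) (ψ) : h 0 ψ = 0 := by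
  have := hb.hl 2 (by norm_num) 0 ψ
  rw [smul_zero] at this
  linarith

/-- The set `A` is described by the bisublinear function `h`. -/
def Describes (e : V ≃ₗ[ℝ] X × Y) (h : Y → Module.Dual ℝ X → ℝ)
    (A : Set (Projectivization ℝ V)) : Prop :=
  ∀ v, v ≠ 0 → (v ∈ coneOf A ↔ ∀ ψ : Module.Dual ℝ X, ψ (e v).1 ≤ h (e v).2 ψ)

theorem dual_eq_zero {x : X} (hx : ∀ ψ : Module.Dual ℝ X, ψ x ≤ 0) : x = 0 := by
  rw [← Module.forall_dual_apply_eq_zero_iff ℝ]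
  intro ψ
  have h1 := hx ψ
  have h2 := hx (-ψ)
  simp only [LinearMap.neg_apply] at h2
  linarith

theorem exists_eq_one {ψ : Module.Dual ℝ X} (hψ : ψ ≠ 0) : ∃ x, ψ x = 1 := by
  obtain ⟨x, hx⟩ : ∃ x, ψ x ≠ 0 := by
    by_contra! h
    exact hψ (LinearMap.ext h)
  exact ⟨(ψ x)⁻¹ • x, by simp [hx]⟩

theorem Describes.snd_ne {e : V ≃ₗ[ℝ] X × Y} {h : Y → Module.Dual ℝ X → ℝ} (hb : Bisub h)
    {A : Set (Projectivization ℝ V)} (hA : Describes e h A) {v : V} (hv : v ∈ coneOf A) :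
    (e v).2 ≠ 0 := by
  intro h0
  have h1 := (hA v (coneOf_ne hv)).1 hv
  rw [h0] at h1
  have h2 : (e v).1 = 0 := dual_eq_zero fun ψ => (h1 ψ).trans_eq (hb.zl ψ)
  exact coneOf_ne hv (e.injective (by rw [map_zero]; exact Prod.ext h2 h0))

theorem symm_ne {e : V ≃ₗ[ℝ] X × Y} {x : X} {y : Y} (hy : y ≠ 0) : e.symm (x, y) ≠ 0 := by
  intro h
  have := congrArg e h
  simp only [LinearEquiv.apply_symm_apply, map_zero] at this
  exact hy (congrArg Prod.snd this)

/-- Attaining all values allowed by the support function. -/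
theorem Describes.attain [FiniteDimensional ℝ X] {e : V ≃ₗ[ℝ] X × Y}
    {h : Y → Module.Dual ℝ X → ℝ} (hb : Bisub h)
    {A : Set (Projectivization ℝ V)} (hA : Describes e h A) (y : Y) (hy : y ≠ 0)
    (ψ : Module.Dual ℝ X) (t : ℝ) :
    (∃ x, e.symm (x, y) ∈ coneOf A ∧ ψ x = t) ↔ t ≤ h y ψ ∧ -t ≤ h y (-ψ) := by
  constructor
  · rintro ⟨x, hx, rfl⟩
    have h1 := (hA _ (symm_ne hy)).1 hx
    simp only [LinearEquiv.apply_symm_apply] at h1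
    exact ⟨h1 ψ, by simpa using h1 (-ψ)⟩
  · rintro ⟨h1, h2⟩
    obtain ⟨F, hF1, hF2⟩ := CC.hb (h y) (fun c hc ψ => hb.hr c hc y ψ) (hb.ar y) ψ t h1 h2
    obtain ⟨x, rfl⟩ := (Module.evalEquiv ℝ X).surjective F
    refine ⟨x, (hA _ (symm_ne hy)).2 fun χ => ?_, by simpa using hF1⟩
    simpa using hF2 χ

theorem N_exists [FiniteDimensional ℝ V] {e : V ≃ₗ[ℝ] X × Y} {W N : Submodule ℝ V}
    (hW : ∀ v, v ∈ W ↔ (e v).2 = 0) (hN : W ≤ N) (hr : finrank ℝ N = finrank ℝ W + 1) :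
    ∃ y : Y, y ≠ 0 ∧ ∀ v, v ∈ N ↔ ∃ s : ℝ, (e v).2 = s • y := by
  obtain ⟨v0, -, h0, rfl⟩ := eq_sup_span hN hr
  refine ⟨(e v0).2, fun h => h0 ((hW v0).2 h), fun v => ?_⟩
  rw [mem_sup_span]
  refine exists_congr fun s => ?_
  rw [hW]
  simp [sub_eq_zero]

theorem N_conv [FiniteDimensional ℝ V] {e : V ≃ₗ[ℝ] X × Y} {W : Submodule ℝ V}
    (hW : ∀ v, v ∈ W ↔ (e v).2 = 0) {y : Y} (hy : y ≠ 0) :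
    ∃ N : Submodule ℝ V, W ≤ N ∧ finrank ℝ N = finrank ℝ W + 1 ∧
      ∀ v, v ∈ N ↔ ∃ s : ℝ, (e v).2 = s • y := by
  have h0 : e.symm (0, y) ∉ W := by rw [hW]; simpa using hy
  refine ⟨W ⊔ Submodule.span ℝ {e.symm (0, y)}, le_sup_left, finrank_sup_span W h0, fun v => ?_⟩
  rw [mem_sup_span]
  refine exists_congr fun s => ?_
  rw [hW]
  simp [sub_eq_zero]

theorem T_exists [FiniteDimensional ℝ V] {e : V ≃ₗ[ℝ] X × Y} {W T : Submodule ℝ V}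
    (hW : ∀ v, v ∈ W ↔ (e v).2 = 0) (hT : T ≤ W) (hr : finrank ℝ T + 1 = finrank ℝ W) :
    ∃ ψ : Module.Dual ℝ X, ψ ≠ 0 ∧ ∀ v, v ∈ T ↔ (e v).2 = 0 ∧ ψ (e v).1 = 0 := by
  obtain ⟨v0, hv0, h0, hWT⟩ := eq_sup_span hT hr.symm
  obtain ⟨f, hf1, hf2⟩ := Submodule.exists_dual_map_eq_bot_of_notMem h0 inferInstance
  have hfT : ∀ t ∈ T, f t = 0 := fun t ht => by
    have : f t ∈ T.map f := Submodule.mem_map_of_mem ht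
    rw [hf2] at this
    simpa using this
  have key : ∀ v ∈ W, (f ∘ₗ e.symm.toLinearMap ∘ₗ LinearMap.inl ℝ X Y) (e v).1 = f v := by
    intro v hv
    have : ((e v).1, (0 : Y)) = e v := Prod.ext rfl ((hW v).1 hv).symm
    simp [this]
  refine ⟨f ∘ₗ e.symm.toLinearMap ∘ₗ LinearMap.inl ℝ X Y, ?_, ?_⟩
  · intro h
    apply hf1
    rw [← key v0 hv0, h]
    rfl
  · intro v
    rw [← hW]
    constructor
    · intro hv
      exact ⟨hT hv, by rw [key v (hT hv)]; exact hfT v hv⟩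
    · rintro ⟨hv, hfv⟩
      rw [key v hv] at hfv
      have hv' := hv
      rw [hWT, mem_sup_span] at hv'
      obtain ⟨s, hs⟩ := hv'
      have := hfT _ hs
      simp only [map_sub, hfv, map_smul, smul_eq_mul, zero_sub, neg_eq_zero, mul_eq_zero, hf1,
        or_false] at this
      simpa [this] using hs

theorem T_conv [FiniteDimensional ℝ V] {e : V ≃ₗ[ℝ] X × Y} {W : Submodule ℝ V}
    (hW : ∀ v, v ∈ W ↔ (e v).2 = 0) {ψ : Module.Dual ℝ X} (hψ : ψ ≠ 0) :
    ∃ T : Submodule ℝ V, T ≤ W ∧ finrank ℝ T + 1 = finrank ℝ W ∧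
      ∀ v, v ∈ T ↔ (e v).2 = 0 ∧ ψ (e v).1 = 0 := by
  obtain ⟨x0, hx0⟩ := exists_eq_one hψ
  let T : Submodule ℝ V := W ⊓ LinearMap.ker (ψ ∘ₗ LinearMap.fst ℝ X Y ∘ₗ e.toLinearMap)
  have hT : ∀ v, v ∈ T ↔ (e v).2 = 0 ∧ ψ (e v).1 = 0 := by
    intro v
    simp [T, hW]
  have h0 : e.symm (x0, 0) ∉ T := by
    rw [hT]
    simp [hx0]
  refine ⟨T, inf_le_left, ?_, hT⟩
  rw [← finrank_sup_span T h0]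
  have : W = T ⊔ Submodule.span ℝ {e.symm (x0, 0)} := by
    ext v
    rw [mem_sup_span, hW]
    simp only [hT, map_sub, map_smul, LinearEquiv.apply_symm_apply, Prod.snd_sub, Prod.smul_snd,
      smul_zero, sub_zero, Prod.fst_sub, Prod.smul_fst, hx0, smul_eq_mul, mul_one]
    constructor
    · intro h
      exact ⟨ψ (e v).1, h, by simp⟩
    · rintro ⟨s, h, -⟩
      exact h
  rw [← this]

/-- The complement of the projection from `T = ker ψ ⊆ W`. -/
theorem compl_char {e : V ≃ₗ[ℝ] X × Y} {W T : Submodule ℝ V}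
    (hW : ∀ v, v ∈ W ↔ (e v).2 = 0) {A : Set (Projectivization ℝ V)}
    {h : Y → Module.Dual ℝ X → ℝ} (ψ : Module.Dual ℝ X)
    (H1 : ∀ v ∈ coneOf A, v ∉ W)
    (H2 : ∀ y ≠ 0, ∀ t, (∃ x, e.symm (x, y) ∈ coneOf A ∧ ψ x = t) ↔
      t ≤ h y ψ ∧ -t ≤ h y (-ψ))
    (H3 : ∀ χ, h 0 χ = 0)
    (hTW : T ≤ W) (hT : ∀ v, v ∈ T ↔ (e v).2 = 0 ∧ ψ (e v).1 = 0) (u : V) :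
    T.mkQ u ∈ coneOf (projImage T A)ᶜ ↔
      h (e u).2 ψ < ψ (e u).1 ∨ h (e u).2 (-ψ) < -ψ (e u).1 := by
  rw [mem_cone_projImage (fun v hv hvT => H1 v hv (hTW hvT))]
  by_cases hy : (e u).2 = 0
  · have : ∀ v ∈ coneOf A, v - u ∉ T := by
      intro v hv hvu
      apply H1 v hv
      have := ((hT _).1 hvu).1
      rw [hW]
      simpa [hy] using this
    simp only [hT, hy, H3, true_and]
    constructor
    · rintro ⟨h1, -⟩
      rcases lt_or_gt_of_ne h1 with h | h
      · right; linarith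
      · left; exact h
    · intro h1
      refine ⟨?_, fun v hv hvu => this v hv ((hT _).2 hvu)⟩
      rcases h1 with h | h
      · exact h.ne'
      · intro h'; linarith
  · have h1 : u ∉ T := by
      rw [hT]; tauto
    have h2 := H2 _ hy (ψ (e u).1)
    have h3 : (∀ v ∈ coneOf A, v - u ∉ T) ↔
        ¬ ∃ x, e.symm (x, (e u).2) ∈ coneOf A ∧ ψ x = ψ (e u).1 := by
      rw [not_exists]
      constructor
      · rintro hh x ⟨hx1, hx2⟩
        apply hh _ hx1
        rw [hT]
        simp [hx2]
      · intro hh v hv hvu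
        rw [hT] at hvu
        simp only [map_sub, Prod.snd_sub, Prod.fst_sub] at hvu
        refine hh (e v).1 ⟨?_, sub_eq_zero.1 hvu.2⟩
        rw [← sub_eq_zero.1 hvu.1]
        simpa using hv
    rw [h3, h2]
    simp only [h1, not_false_eq_true, true_and, not_and_or, not_le]

theorem evalE_apply [FiniteDimensional ℝ X] (x : X) (ψ : Module.Dual ℝ X) :
    (Module.evalEquiv ℝ X x) ψ = ψ x := rfl

/-- A set described by a bisublinear function is convex-concave. -/
theorem Describes.isLConvexConcave [TopologicalSpace V] [IsTopologicalAddGroup V]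
    [ContinuousSMul ℝ V] [T2Space V] [FiniteDimensional ℝ V] [FiniteDimensional ℝ X]
    {e : V ≃ₗ[ℝ] X × Y} {W : Submodule ℝ V}
    (hW : ∀ v, v ∈ W ↔ (e v).2 = 0) {h : Y → Module.Dual ℝ X → ℝ} (hb : Bisub h)
    {A : Set (Projectivization ℝ V)} (hA : Describes e h A) : IsLConvexConcave W A := by
  have hcont : ∀ ψ, Continuous fun v : V => h (e v).2 ψ := by
    intro ψ
    apply continuous_sublinear
    · intro c hc x
      simp [hb.hl c hc]
    · intro x y
      simpa using hb.al _ _ _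
  have hlin : ∀ ψ : Module.Dual ℝ X, Continuous fun v : V => ψ (e v).1 := fun ψ =>
    LinearMap.continuous_of_finiteDimensional (ψ ∘ₗ LinearMap.fst ℝ X Y ∘ₗ e.toLinearMap)
  have H1 : ∀ v ∈ coneOf A, v ∉ W := fun v hv hvW => hA.snd_ne hb hv ((hW v).1 hvW)
  refine ⟨?_, fun x hx => H1 _ (coneOf_rep.2 hx), ?_, ?_⟩
  · rw [← isOpen_compl_iff, isOpen_iff_cone]
    refine ⟨{v | ∀ ψ : Module.Dual ℝ X, ψ (e v).1 ≤ h (e v).2 ψ}ᶜ, ?_, ?_⟩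
    · rw [isOpen_compl_iff]
      have : {v | ∀ ψ : Module.Dual ℝ X, ψ (e v).1 ≤ h (e v).2 ψ}
          = ⋂ ψ : Module.Dual ℝ X, {v | ψ (e v).1 ≤ h (e v).2 ψ} := by
        ext v; simp
      rw [this]
      exact isClosed_iInter fun ψ => isClosed_le (hlin ψ) (hcont ψ)
    · intro v hv
      rw [coneOf_compl, hA v hv]
      simp [hv]
  · intro N hWN hr
    obtain ⟨y, hy, hN⟩ := N_exists hW hWN hr
    have hne : ∀ v ∈ coneOf (A ∩ projSet N), ∃ s : ℝ, s ≠ 0 ∧ (e v).2 = s • y := by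
      intro v hv
      rw [coneOf_inter_projSet] at hv
      obtain ⟨s, hs⟩ := (hN v).1 hv.2
      refine ⟨s, ?_, hs⟩
      rintro rfl
      exact hA.snd_ne hb hv.1 (by simpa using hs)
    constructor
    · have h0 : h y 0 = 0 := by
        have := hb.hr 2 (by norm_num) y 0
        rw [smul_zero] at this
        linarith
      obtain ⟨x, hx, -⟩ := (hA.attain hb y hy 0 0).2 ⟨by rw [h0], by simp [h0]⟩
      have : e.symm (x, y) ∈ coneOf (A ∩ projSet N) :=
        coneOf_inter_projSet.2 ⟨hx, (hN _).2 ⟨1, by simp⟩⟩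
      exact ⟨_, this.2⟩
    · obtain ⟨l, hl⟩ := Module.Projective.exists_dual_eq_one ℝ hy
      let φ : Module.Dual ℝ V := l ∘ₗ LinearMap.snd ℝ X Y ∘ₗ e.toLinearMap
      have hφ : ∀ v, φ v = l (e v).2 := fun v => rfl
      refine isProjConvex_of φ ?_ ?_ ?_
      · intro h0
        have := hφ (e.symm (0, y))
        simp [h0, hl] at this
      · intro v hv
        obtain ⟨s, hs, hs'⟩ := hne v hv
        rw [hφ, hs']
        simpa [hl] using hs
      · have : {v | φ v = 1 ∧ v ∈ coneOf (A ∩ projSet N)}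
            = {v | (e v).2 = y ∧ ∀ ψ : Module.Dual ℝ X, ψ (e v).1 ≤ h y ψ} := by
          ext v
          constructor
          · rintro ⟨h1, h2⟩
            obtain ⟨s, hs, hs'⟩ := hne v h2
            rw [hφ, hs'] at h1
            have hs1 : s = 1 := by simpa [hl] using h1
            have hy' : (e v).2 = y := by rw [hs', hs1, one_smul]
            have h3 := (hA v (coneOf_ne h2)).1 (coneOf_inter_projSet.1 h2).1
            rw [hy'] at h3
            exact ⟨hy', h3⟩
          · rintro ⟨h1, h2⟩
            have hv : v ≠ 0 := by
              rintro rfl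
              apply hy
              rw [← h1]; simp
            refine ⟨by rw [hφ, h1, hl], coneOf_inter_projSet.2 ⟨(hA v hv).2 ?_, ?_⟩⟩
            · rw [h1]; exact h2
            · exact (hN v).2 ⟨1, by simp [h1]⟩
        rw [this]
        rintro v ⟨hv1, hv2⟩ w ⟨hw1, hw2⟩ a b ha hb' hab
        refine ⟨?_, fun ψ => ?_⟩
        · simp only [map_add, map_smul, Prod.snd_add, Prod.smul_snd, hv1, hw1]
          rw [← add_smul, hab, one_smul]
        · simp only [map_add, map_smul, Prod.fst_add, Prod.smul_fst, smul_eq_mul]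
          have h1 := mul_le_mul_of_nonneg_left (hv2 ψ) ha
          have h2 := mul_le_mul_of_nonneg_left (hw2 ψ) hb'
          have h3 : h y ψ = a * h y ψ + b * h y ψ := by rw [← add_mul, hab, one_mul]
          linarith
  · intro T hTW hr
    obtain ⟨ψ, hψ, hT⟩ := T_exists hW hTW hr
    have hchar := compl_char hW (A := A) (h := h) ψ H1 (fun y hy t => hA.attain hb y hy ψ t)
      hb.zl hTW hT
    constructor
    · rw [isOpen_iff_cone]
      refine ⟨coneOf (projImage T A)ᶜ, ?_, fun v _ => Iff.rfl⟩
      rw [← (T.isOpenQuotientMap_mkQ).isQuotientMap.isOpen_preimage]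
      have : T.mkQ ⁻¹' coneOf (projImage T A)ᶜ = {u | h (e u).2 ψ < ψ (e u).1} ∪
          {u | h (e u).2 (-ψ) < -ψ (e u).1} := by
        ext u
        exact hchar u
      rw [this]
      exact (isOpen_lt (hcont ψ) (hlin ψ)).union (isOpen_lt (hcont (-ψ)) (hlin ψ).neg)
    · obtain ⟨l, -, hl⟩ := CC.hb (fun y => h y ψ) (fun c hc y => hb.hl c hc y ψ)
        (fun y z => hb.al y z ψ) 0 0 (hb.zl ψ).ge (by simp [hb.zl])
      let φ₀ : Module.Dual ℝ V := ψ ∘ₗ LinearMap.fst ℝ X Y ∘ₗ e.toLinearMap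
        - l ∘ₗ LinearMap.snd ℝ X Y ∘ₗ e.toLinearMap
      have hφ₀ : ∀ v, φ₀ v = ψ (e v).1 - l (e v).2 := fun v => rfl
      have hker : T ≤ LinearMap.ker φ₀ := by
        intro v hv
        obtain ⟨h1, h2⟩ := (hT v).1 hv
        rw [LinearMap.mem_ker, hφ₀, h1, h2]
        simp
      let φ : Module.Dual ℝ (V ⧸ T) := T.liftQ φ₀ hker
      have hφ : ∀ v, φ (T.mkQ v) = ψ (e v).1 - l (e v).2 := fun v => by
        simp [φ, hφ₀]
      have hneg : ∀ u, h (e u).2 (-ψ) < -ψ (e u).1 → φ (T.mkQ u) < 0 := by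
        intro u hu
        rw [hφ]
        have h1 := hl (-(e u).2)
        simp only [hb.neg, map_neg] at h1
        linarith
      have hpos : ∀ u, h (e u).2 ψ < ψ (e u).1 → 0 < φ (T.mkQ u) := by
        intro u hu
        rw [hφ]
        have h1 := hl ((e u).2)
        linarith
      refine isProjConvex_of φ ?_ ?_ ?_
      · obtain ⟨x0, hx0⟩ := exists_eq_one hψ
        intro h0
        have := hφ (e.symm (x0, 0))
        simp [h0, hx0] at this
      · intro q hq
        obtain ⟨u, rfl⟩ := T.mkQ_surjective q
        rcases (hchar u).1 hq with h1 | h1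
        · exact (hpos u h1).ne'
        · exact (hneg u h1).ne
      · have key : ∀ u, φ (T.mkQ u) = 1 → T.mkQ u ∈ coneOf (projImage T A)ᶜ →
            h (e u).2 ψ < ψ (e u).1 := by
          intro u h1 h2
          rcases (hchar u).1 h2 with h3 | h3
          · exact h3
          · have := hneg u h3
            linarith
        rintro p ⟨hp1, hp2⟩ q ⟨hq1, hq2⟩ a b ha hb' hab
        obtain ⟨u, rfl⟩ := T.mkQ_surjective p
        obtain ⟨v, rfl⟩ := T.mkQ_surjective q
        have hu := key u hp1 hp2
        have hv := key v hq1 hq2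
        refine ⟨by rw [map_add, map_smul, map_smul, hp1, hq1]; simpa using hab, ?_⟩
        rcases ha.eq_or_lt with ha | ha
        · have : b = 1 := by linarith
          subst this
          rw [← ha]
          simpa using hq2
        rcases hb'.eq_or_lt with hb' | hb'
        · have : a = 1 := by linarith
          subst this
          rw [← hb']
          simpa using hp2
        rw [← map_smul, ← map_smul, ← map_add, hchar]
        left
        simp only [map_add, map_smul, Prod.fst_add, Prod.smul_fst, Prod.snd_add, Prod.smul_snd,
          smul_eq_mul]
        refine (hb.al _ _ _).trans_lt ?_
        rw [hb.hl a ha, hb.hl b hb']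
        have h1 := mul_lt_mul_of_pos_left hu ha
        have h2 := mul_lt_mul_of_pos_left hv hb'
        linarith

/-- The dual coordinates. -/
def dualCoord (e : V ≃ₗ[ℝ] X × Y) :
    Module.Dual ℝ V ≃ₗ[ℝ] Module.Dual ℝ Y × Module.Dual ℝ X where
  toFun ξ := (ξ ∘ₗ e.symm.toLinearMap ∘ₗ LinearMap.inr ℝ X Y,
    ξ ∘ₗ e.symm.toLinearMap ∘ₗ LinearMap.inl ℝ X Y)
  map_add' ξ η := by ext <;> simp
  map_smul' c ξ := by ext <;> simp
  invFun p := p.1 ∘ₗ LinearMap.snd ℝ X Y ∘ₗ e.toLinearMap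
    + p.2 ∘ₗ LinearMap.fst ℝ X Y ∘ₗ e.toLinearMap
  left_inv ξ := by
    ext v
    simp only [LinearMap.add_apply, LinearMap.comp_apply, LinearMap.snd_apply,
      LinearMap.fst_apply, LinearEquiv.coe_coe, LinearMap.inr_apply, LinearMap.inl_apply]
    rw [← map_add, ← map_add]
    simp
  right_inv p := by
    refine Prod.ext ?_ ?_ <;> ext z <;> simp

theorem dualCoord_apply (e : V ≃ₗ[ℝ] X × Y) (ξ : Module.Dual ℝ V) (v : V) :
    ξ v = (dualCoord e ξ).1 (e v).2 + (dualCoord e ξ).2 (e v).1 := by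
  conv_lhs => rw [← (dualCoord e).symm_apply_apply ξ]
  rfl

/-- The dual function. -/
def dualFun [FiniteDimensional ℝ Y] (h : Y → Module.Dual ℝ X → ℝ) :
    Module.Dual ℝ X → Module.Dual ℝ (Module.Dual ℝ Y) → ℝ :=
  fun ψ η => h (-(Module.evalEquiv ℝ Y).symm η) ψ

theorem Bisub.dualFun [FiniteDimensional ℝ Y] {h : Y → Module.Dual ℝ X → ℝ} (hb : Bisub h) :
    Bisub (dualFun h) where
  hl c hc ψ η := by simp only [CC.dualFun, hb.hr c hc]
  hr c hc ψ η := by simp only [CC.dualFun, map_smul, ← smul_neg, hb.hl c hc]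
  al ψ χ η := hb.ar _ _ _
  ar ψ η θ := by
    simp only [CC.dualFun, map_add, neg_add]
    exact hb.al _ _ _
  neg ψ η := by simp only [CC.dualFun, map_neg, hb.neg, neg_neg]

theorem dualAnnihilator_char {e : V ≃ₗ[ℝ] X × Y} {W : Submodule ℝ V}
    (hW : ∀ v, v ∈ W ↔ (e v).2 = 0) (ξ : Module.Dual ℝ V) :
    ξ ∈ W.dualAnnihilator ↔ (dualCoord e ξ).2 = 0 := by
  rw [Submodule.mem_dualAnnihilator]
  constructor
  · intro h
    ext x
    exact h _ ((hW _).2 (by simp))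
  · intro h w hw
    rw [dualCoord_apply e, h, (hW w).1 hw]
    simp

theorem mem_LdualSet {W : Submodule ℝ V} {A : Set (Projectivization ℝ V)} {ξ : Module.Dual ℝ V}
    (hξ : ξ ≠ 0) :
    ξ ∈ coneOf (LdualSet W A) ↔ ∀ N : Submodule ℝ V, W ≤ N → finrank ℝ N = finrank ℝ W + 1 →
      ∃ v ∈ coneOf A, ξ v = 0 ∧ v ∈ N := by
  rw [coneOf_mk hξ]
  obtain ⟨c, hc, hr⟩ := rep_eq hξ
  refine forall_congr' fun N => imp_congr_right fun _ => imp_congr_right fun _ => ?_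
  simp only [Incident, hr, LinearMap.smul_apply, smul_eq_mul, mul_eq_zero, hc, false_or]
  constructor
  · rintro ⟨x, hx, h1, h2⟩
    exact ⟨x.rep, coneOf_rep.2 hx, h1, h2⟩
  · rintro ⟨v, ⟨hv, hvA⟩, h1, h2⟩
    obtain ⟨d, hd, hr'⟩ := rep_eq hv
    refine ⟨_, hvA, ?_, ?_⟩
    · rw [hr', map_smul, h1, smul_zero]
    · rw [hr']
      exact N.smul_mem d h2

theorem Describes.dual [FiniteDimensional ℝ V] [FiniteDimensional ℝ X] [FiniteDimensional ℝ Y]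
    {e : V ≃ₗ[ℝ] X × Y} {W : Submodule ℝ V}
    (hW : ∀ v, v ∈ W ↔ (e v).2 = 0) {h : Y → Module.Dual ℝ X → ℝ} (hb : Bisub h)
    {A : Set (Projectivization ℝ V)} (hA : Describes e h A) :
    Describes (dualCoord e) (dualFun h) (LdualSet W A) := by
  intro ξ hξ
  rw [mem_LdualSet hξ]
  have step1 : (∀ η : Module.Dual ℝ (Module.Dual ℝ Y),
      η (dualCoord e ξ).1 ≤ dualFun h (dualCoord e ξ).2 η) ↔
      ∀ y, -(dualCoord e ξ).1 y ≤ h y (dualCoord e ξ).2 := by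
    constructor
    · intro H y
      have := H (-(Module.evalEquiv ℝ Y y))
      simpa only [CC.dualFun, map_neg, LinearEquiv.symm_apply_apply, neg_neg,
        LinearMap.neg_apply, evalE_apply] using this
    · intro H η
      obtain ⟨y, rfl⟩ := (Module.evalEquiv ℝ Y).surjective η
      have := H (-y)
      simpa only [CC.dualFun, LinearEquiv.symm_apply_apply, evalE_apply, map_neg,
        neg_neg] using this
  rw [step1]
  constructor
  · intro H y
    by_cases hy : y = 0
    · simp [hy, hb.zl]
    obtain ⟨N, hWN, hr, hN⟩ := N_conv hW hy
    obtain ⟨v, hv, h1, h2⟩ := H N hWN hr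
    obtain ⟨s, hs⟩ := (hN v).1 h2
    have hs0 : s ≠ 0 := by
      rintro rfl
      exact hA.snd_ne hb hv (by simpa using hs)
    have hv' : s⁻¹ • v ∈ coneOf A := (coneOf_smul (inv_ne_zero hs0)).2 hv
    have h3 : (e (s⁻¹ • v)).2 = y := by
      simp [hs, smul_smul, hs0]
    have h4 := (hA _ (coneOf_ne hv')).1 hv' (dualCoord e ξ).2
    have h5 := dualCoord_apply e ξ (s⁻¹ • v)
    rw [h3] at h4 h5
    rw [map_smul, h1, smul_zero] at h5
    linarith
  · intro H N hWN hr
    obtain ⟨y, hy, hN⟩ := N_exists hW hWN hr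
    obtain ⟨x, hx, hx'⟩ := (hA.attain hb y hy (dualCoord e ξ).2 (-(dualCoord e ξ).1 y)).2
      ⟨H y, by simpa [hb.neg] using H (-y)⟩
    refine ⟨_, hx, ?_, (hN _).2 ⟨1, by simp⟩⟩
    rw [dualCoord_apply e]
    simp [hx']

theorem bidual_eq [FiniteDimensional ℝ V] [FiniteDimensional ℝ X] [FiniteDimensional ℝ Y]
    {e : V ≃ₗ[ℝ] X × Y} {W : Submodule ℝ V}
    (hW : ∀ v, v ∈ W ↔ (e v).2 = 0) {h : Y → Module.Dual ℝ X → ℝ} (hb : Bisub h)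
    {A : Set (Projectivization ℝ V)} (hA : Describes e h A) : Lbidual W A = A := by
  have hD := (hA.dual hW hb).dual (dualAnnihilator_char hW) hb.dualFun
  ext x
  induction x using Projectivization.ind with
  | h v hv =>
    have hv' : Module.evalEquiv ℝ V v ≠ 0 :=
      (LinearEquiv.map_ne_zero_iff _).2 hv
    have h1 : Projectivization.mk ℝ v hv ∈ Lbidual W A ↔ Module.evalEquiv ℝ V v ∈
        coneOf (LdualSet W.dualAnnihilator (LdualSet W A)) := by
      rw [coneOf_mk hv']
      rfl
    rw [h1, hD _ hv', ← coneOf_mk hv, hA v hv]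
    have e1 : (dualCoord (dualCoord e) (Module.evalEquiv ℝ V v)).1
        = Module.evalEquiv ℝ X (e v).1 := by
      ext ψ
      simp [dualCoord]
    have e2 : (dualCoord (dualCoord e) (Module.evalEquiv ℝ V v)).2
        = Module.evalEquiv ℝ Y (e v).2 := by
      ext c
      simp [dualCoord]
    rw [e1, e2]
    constructor
    · intro H ψ
      have := H (Module.evalEquiv ℝ _ ψ)
      simpa only [CC.dualFun, LinearEquiv.symm_apply_apply, map_neg, hb.neg, neg_neg,
        evalE_apply] using this
    · intro H Ψ
      obtain ⟨ψ, rfl⟩ := (Module.evalEquiv ℝ _).surjective Ψ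
      have := H ψ
      simpa only [CC.dualFun, LinearEquiv.symm_apply_apply, map_neg, hb.neg, neg_neg,
        evalE_apply] using this

/-- Every convex-concave set is described by a bisublinear function. -/
theorem exists_describes {V X Y : Type*} [AddCommGroup V] [Module ℝ V]
    [TopologicalSpace V] [IsTopologicalAddGroup V]
    [ContinuousSMul ℝ V] [T2Space V] [FiniteDimensional ℝ V]
    [NormedAddCommGroup X] [NormedSpace ℝ X] [FiniteDimensional ℝ X]
    [AddCommGroup Y] [Module ℝ Y]
    {e : V ≃ₗ[ℝ] X × Y} {W : Submodule ℝ V}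
    (hW : ∀ v, v ∈ W ↔ (e v).2 = 0)
    {A : Set (Projectivization ℝ V)} (hA : IsLConvexConcave W A) :
    ∃ h : Y → Module.Dual ℝ X → ℝ, Bisub h ∧ Describes e h A := by
  obtain ⟨hclosed, hdisj, hsec, hproj⟩ := hA
  have H1 : ∀ v ∈ coneOf A, v ∉ W := by
    rintro v ⟨hv, hvA⟩ hvW
    obtain ⟨c, hc, hr⟩ := rep_eq hv
    exact hdisj _ hvA (by rw [hr]; exact W.smul_mem c hvW)
  have H1' : ∀ v ∈ coneOf A, (e v).2 ≠ 0 := fun v hv h0 => H1 v hv ((hW v).2 h0)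
  let K : Y → Set X := fun y => {x | e.symm (x, y) ∈ coneOf A}
  have hK : ∀ x y, x ∈ K y ↔ e.symm (x, y) ∈ coneOf A := fun _ _ => Iff.rfl
  have hKv : ∀ v, (e v).1 ∈ K (e v).2 ↔ v ∈ coneOf A := fun v => by
    rw [hK]; simp
  have K0 : K 0 = ∅ := by
    ext x
    simp only [hK, mem_empty_iff_false, iff_false]
    intro hx
    exact H1' _ hx (by simp)
  have Ksmul : ∀ c : ℝ, c ≠ 0 → ∀ x y, c • x ∈ K (c • y) ↔ x ∈ K y := by
    intro c hc x y
    rw [hK, hK, ← coneOf_smul hc (v := e.symm (x, y)), ← map_smul]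
    rfl
  have Kne : ∀ y, y ≠ 0 → (K y).Nonempty := by
    intro y hy
    obtain ⟨N, hWN, hr, hN⟩ := N_conv hW hy
    obtain ⟨x, hx⟩ := (hsec N hWN hr).1
    have h1 := coneOf_inter_projSet.1 (coneOf_rep.2 hx)
    obtain ⟨s, hs⟩ := (hN _).1 h1.2
    have hs0 : s ≠ 0 := by
      rintro rfl
      exact H1' _ h1.1 (by simpa using hs)
    have h2 := (hKv _).2 h1.1
    rw [hs] at h2
    refine ⟨s⁻¹ • (e x.rep).1, ?_⟩
    rw [← Ksmul s hs0, smul_smul, mul_inv_cancel₀ hs0, one_smul]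
    exact h2
  have Kconv : ∀ y, y ≠ 0 → Convex ℝ (K y) := by
    intro y hy x1 hx1 x2 hx2 a b ha hb hab
    obtain ⟨N, hWN, hr, hN⟩ := N_conv hW hy
    obtain ⟨φ, hφ, hadd⟩ := isProjConvex_to (hsec N hWN hr).2
    have hmem : ∀ x ∈ K y, e.symm (x, y) ∈ coneOf (A ∩ projSet N) := fun x hx =>
      coneOf_inter_projSet.2 ⟨hx, (hN _).2 ⟨1, by simp⟩⟩
    have m1 := hmem x1 hx1
    have m2 := hmem x2 hx2
    have hpos : 0 < φ (e.symm (x1, y)) * φ (e.symm (x2, y)) := by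
      by_contra hneg
      have hlt : φ (e.symm (x1, y)) * φ (e.symm (x2, y)) < 0 :=
        lt_of_le_of_ne (not_lt.1 hneg) (mul_ne_zero (hφ _ m1) (hφ _ m2))
      have := hadd _ m1 _ (coneOf_neg.2 m2) (by rw [map_neg]; linarith)
      refine H1' _ (coneOf_inter_projSet.1 this).1 ?_
      simp
    rcases ha.eq_or_lt with ha | ha
    · have : b = 1 := by linarith
      subst this
      simpa [← ha] using hx2
    rcases hb.eq_or_lt with hb | hb
    · have : a = 1 := by linarith
      subst this
      simpa [← hb] using hx1
    have := hadd _ ((coneOf_smul ha.ne').2 m1) _ ((coneOf_smul hb.ne').2 m2) (by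
      rw [map_smul, map_smul, smul_eq_mul, smul_eq_mul]
      have := mul_pos (mul_pos ha hb) hpos
      linarith)
    have h2 := (coneOf_inter_projSet.1 this).1
    rw [hK]
    convert h2 using 1
    rw [← map_smul, ← map_smul, ← map_add]
    congr 1
    ext
    · simp
    · simp [← add_smul, hab]
  have Kclosed : ∀ y, y ≠ 0 → IsClosed (K y) := by
    intro y hy
    obtain ⟨U, hU, hUA⟩ := isOpen_iff_cone.1 (isOpen_compl_iff.2 hclosed)
    have hc : Continuous fun x : X => e.symm (x, y) := by
      have h1 : Continuous (e.symm.toLinearMap ∘ₗ LinearMap.inl ℝ X Y) :=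
        LinearMap.continuous_of_finiteDimensional _
      have h2 : (fun x : X => e.symm (x, y)) =
          fun x => (e.symm.toLinearMap ∘ₗ LinearMap.inl ℝ X Y) x + e.symm (0, y) := by
        ext x
        simp [← map_add]
      rw [h2]
      exact h1.add continuous_const
    have : K y = (fun x : X => e.symm (x, y)) ⁻¹' Uᶜ := by
      ext x
      have := hUA _ (symm_ne (e := e) (x := x) hy)
      rw [coneOf_compl] at this
      simp only [mem_preimage, mem_compl_iff, this, hK]
      simp [symm_ne hy]
    rw [this]
    exact hU.isClosed_compl.preimage hc
  have himg : ∀ (ψ : Module.Dual ℝ X) y, y ≠ 0 → BddAbove (ψ '' K y) ∧ IsClosed (ψ '' K y) := by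
    intro ψ y hy
    by_cases hψ : ψ = 0
    · subst hψ
      have : (0 : Module.Dual ℝ X) '' K y = {0} := by
        obtain ⟨x, hx⟩ := Kne y hy
        ext t
        constructor
        · rintro ⟨z, -, rfl⟩
          rfl
        · rintro rfl
          exact ⟨x, hx, rfl⟩
      rw [this]
      exact ⟨bddAbove_singleton, isClosed_singleton⟩
    obtain ⟨T, hTW, hr, hT⟩ := T_conv hW hψ
    obtain ⟨U', hU', hUA'⟩ := isOpen_iff_cone.1 (hproj T hTW hr).1
    have hUo : IsOpen (T.mkQ ⁻¹' U') := hU'.preimage (T.isOpenQuotientMap_mkQ).continuous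
    have hU : ∀ u, u ∉ T → (u ∈ T.mkQ ⁻¹' U' ↔ ∀ v ∈ coneOf A, v - u ∉ T) := by
      intro u hu
      rw [mem_preimage, hUA' _ (by simpa using hu),
        mem_cone_projImage (fun v hv hvT => H1 v hv (hTW hvT))]
      simp [hu]
    obtain ⟨x0, hx0⟩ := exists_eq_one hψ
    constructor
    · have hc : Continuous fun s : ℝ => e.symm (x0, 0) + s • e.symm (0, y) :=
        continuous_const.add (continuous_id.smul continuous_const)
      have hcs : ∀ s : ℝ, e.symm (x0, 0) + s • e.symm (0, y) = e.symm (x0, s • y) := by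
        intro s
        rw [← map_smul, ← map_add]
        simp
      have hnT : ∀ s : ℝ, e.symm (x0, 0) + s • e.symm (0, y) ∉ T := by
        intro s
        rw [hcs, hT]
        simp [hx0]
      have h0 : (0 : ℝ) ∈ (fun s : ℝ => e.symm (x0, 0) + s • e.symm (0, y)) ⁻¹'
          (T.mkQ ⁻¹' U') := by
        rw [mem_preimage, hU _ (hnT 0)]
        intro v hv hvT
        apply H1' v hv
        have := ((hT _).1 hvT).1
        simpa using this
      obtain ⟨ε, hε, hball⟩ := Metric.isOpen_iff.1 (hUo.preimage hc) 0 h0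
      refine ⟨2 / ε, ?_⟩
      rintro _ ⟨x, hx, rfl⟩
      by_contra hlt
      push Not at hlt
      have hp : 0 < ψ x := lt_trans (by positivity) hlt
      have hs : (ψ x)⁻¹ ∈ Metric.ball (0 : ℝ) ε := by
        rw [Metric.mem_ball, Real.dist_eq, sub_zero, abs_of_pos (inv_pos.2 hp),
          inv_lt_comm₀ hp hε]
        refine lt_trans ?_ hlt
        rw [inv_eq_one_div]
        gcongr
        norm_num
      have h1 := (hU _ (hnT _)).1 (hball hs)
      refine h1 ((ψ x)⁻¹ • e.symm (x, y)) ((coneOf_smul (inv_ne_zero hp.ne')).2 hx) ?_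
      rw [hcs, hT]
      simp [hx0, hp.ne']
    · have hc : Continuous fun t : ℝ => t • e.symm (x0, 0) + e.symm (0, y) :=
        (continuous_id.smul continuous_const).add continuous_const
      have hcs : ∀ t : ℝ, t • e.symm (x0, 0) + e.symm (0, y) = e.symm (t • x0, y) := by
        intro s
        rw [← map_smul, ← map_add]
        simp
      have hnT : ∀ t : ℝ, t • e.symm (x0, 0) + e.symm (0, y) ∉ T := by
        intro s
        rw [hcs, hT]
        simp [hy]
      rw [← isOpen_compl_iff]
      have : (ψ '' K y)ᶜ = (fun t : ℝ => t • e.symm (x0, 0) + e.symm (0, y)) ⁻¹'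
          (T.mkQ ⁻¹' U') := by
        ext t
        rw [mem_preimage, hU _ (hnT t), mem_compl_iff]
        constructor
        · intro ht v hv hvT
          rw [hcs, hT] at hvT
          simp only [map_sub, LinearEquiv.apply_symm_apply, Prod.snd_sub, Prod.fst_sub,
            sub_eq_zero, map_smul, hx0, smul_eq_mul, mul_one] at hvT
          refine ht ⟨(e v).1, ?_, hvT.2⟩
          rw [← hvT.1, hKv]
          exact hv
        · rintro ht ⟨x, hx, rfl⟩
          refine ht _ hx ?_
          rw [hcs, hT]
          simp [hx0]
      rw [this]
      exact hUo.preimage hc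
  let h : Y → Module.Dual ℝ X → ℝ := fun y ψ => sSup (ψ '' K y)
  have hh : ∀ y ψ, h y ψ = sSup (ψ '' K y) := fun _ _ => rfl
  have h0 : ∀ ψ, h 0 ψ = 0 := by
    intro ψ
    rw [hh, K0, image_empty, Real.sSup_empty]
  have hgr : ∀ y, y ≠ 0 → ∀ ψ, (∃ x ∈ K y, ψ x = h y ψ) ∧ ∀ x ∈ K y, ψ x ≤ h y ψ := by
    intro y hy ψ
    obtain ⟨hb, hc⟩ := himg ψ y hy
    exact ⟨hc.csSup_mem ((Kne y hy).image _) hb, fun x hx => le_csSup hb ⟨x, hx, rfl⟩⟩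
  have hneg : ∀ y ψ, h (-y) ψ = h y (-ψ) := by
    intro y ψ
    rw [hh, hh]
    congr 1
    ext t
    constructor
    · rintro ⟨x, hx, rfl⟩
      refine ⟨-x, ?_, by simp⟩
      have := (Ksmul (-1) (by norm_num) (-x) y)
      simp only [neg_smul, one_smul, neg_neg] at this
      exact this.1 hx
    · rintro ⟨x, hx, rfl⟩
      refine ⟨-x, ?_, by simp⟩
      have := (Ksmul (-1) (by norm_num) x y)
      simp only [neg_smul, one_smul] at this
      exact this.2 hx
  have hhl : ∀ c : ℝ, 0 < c → ∀ y ψ, h (c • y) ψ = c * h y ψ := by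
    intro c hc y ψ
    rw [hh, hh, ← smul_eq_mul, ← Real.sSup_smul_of_nonneg hc.le]
    congr 1
    ext t
    rw [mem_smul_set]
    constructor
    · rintro ⟨x, hx, rfl⟩
      refine ⟨ψ (c⁻¹ • x), ⟨_, ?_, rfl⟩, ?_⟩
      · rw [← Ksmul c hc.ne', smul_smul, mul_inv_cancel₀ hc.ne', one_smul]
        exact hx
      · simp [hc.ne']
    · rintro ⟨_, ⟨x, hx, rfl⟩, rfl⟩
      exact ⟨c • x, (Ksmul c hc.ne' _ _).2 hx, by simp⟩
  have hhr : ∀ c : ℝ, 0 < c → ∀ y ψ, h y (c • ψ) = c * h y ψ := by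
    intro c hc y ψ
    rw [hh, hh, ← smul_eq_mul, ← Real.sSup_smul_of_nonneg hc.le]
    congr 1
    ext t
    rw [mem_smul_set]
    constructor
    · rintro ⟨x, hx, rfl⟩
      exact ⟨ψ x, ⟨_, hx, rfl⟩, rfl⟩
    · rintro ⟨_, ⟨x, hx, rfl⟩, rfl⟩
      exact ⟨x, hx, rfl⟩
  have har : ∀ y ψ χ, h y (ψ + χ) ≤ h y ψ + h y χ := by
    intro y ψ χ
    by_cases hy : y = 0
    · simp [hy, h0]
    obtain ⟨x, hx, hx'⟩ := (hgr y hy (ψ + χ)).1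
    rw [← hx']
    exact add_le_add ((hgr y hy ψ).2 x hx) ((hgr y hy χ).2 x hx)
  have hattain : ∀ ψ : Module.Dual ℝ X, ∀ y ≠ 0, ∀ t,
      (∃ x, e.symm (x, y) ∈ coneOf A ∧ ψ x = t) ↔ t ≤ h y ψ ∧ -t ≤ h y (-ψ) := by
    intro ψ y hy t
    constructor
    · rintro ⟨x, hx, rfl⟩
      exact ⟨(hgr y hy ψ).2 x hx, by simpa using (hgr y hy (-ψ)).2 x hx⟩
    · rintro ⟨h1, h2⟩
      obtain ⟨x1, hx1, hx1'⟩ := (hgr y hy ψ).1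
      obtain ⟨x2, hx2, hx2'⟩ := (hgr y hy (-ψ)).1
      have hoc : (ψ '' K y).OrdConnected := ((Kconv y hy).linear_image ψ).ordConnected
      obtain ⟨x, hx, hx'⟩ := hoc.out ⟨x2, hx2, rfl⟩ ⟨x1, hx1, rfl⟩
        (show t ∈ Icc (ψ x2) (ψ x1) from ⟨by
          simp only [LinearMap.neg_apply] at hx2'
          linarith, by linarith⟩)
      exact ⟨x, hx, hx'⟩
  have hal : ∀ y z ψ, h (y + z) ψ ≤ h y ψ + h z ψ := by
    intro y z ψ
    by_cases hψ : ψ = 0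
    · have : ∀ y, h y 0 = 0 := by
        intro y
        have := hhr 2 (by norm_num) y 0
        rw [smul_zero] at this
        linarith
      simp [hψ, this]
    obtain ⟨x0, hx0⟩ := exists_eq_one hψ
    obtain ⟨T, hTW, hr, hT⟩ := T_conv hW hψ
    have hchar := compl_char hW (A := A) (h := h) ψ H1 (hattain ψ) h0 hTW hT
    obtain ⟨φ, hφ, hadd⟩ := isProjConvex_to (hproj T hTW hr).2
    -- the sign of `φ` on the positive part of the cone
    let p : V := e.symm (x0, 0)
    have hp : h (e p).2 ψ < ψ (e p).1 := by
      simp [p, h0, hx0]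
    have hp0 : φ (T.mkQ p) ≠ 0 := hφ _ ((hchar p).2 (Or.inl hp))
    have hsign : ∀ u, h (e u).2 ψ < ψ (e u).1 → 0 < φ (T.mkQ u) * φ (T.mkQ p) := by
      intro u hu
      by_contra hle
      have hs : 0 ≤ -φ (T.mkQ u) / φ (T.mkQ p) := by
        have : -φ (T.mkQ u) / φ (T.mkQ p)
            = -(φ (T.mkQ u) * φ (T.mkQ p)) / (φ (T.mkQ p) * φ (T.mkQ p)) := by
          field_simp
        rw [this]
        apply div_nonneg
        · linarith
        · exact mul_self_nonneg _
      have hmem : h (e (u + (-φ (T.mkQ u) / φ (T.mkQ p)) • p)).2 ψ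
          < ψ (e (u + (-φ (T.mkQ u) / φ (T.mkQ p)) • p)).1 := by
        simp only [p, map_add, map_smul, LinearEquiv.apply_symm_apply, Prod.snd_add,
          Prod.smul_snd, smul_zero, add_zero, Prod.fst_add, Prod.smul_fst, hx0, smul_eq_mul,
          mul_one]
        have := hs
        simp only [p] at this
        linarith
      apply hφ _ ((hchar _).2 (Or.inl hmem))
      rw [map_add, map_smul, map_add, map_smul, smul_eq_mul]
      field_simp
      ring
    have key : ∀ s t : ℝ, h y ψ < s → h z ψ < t → h (y + z) ψ < s + t := by
      intro s t hs ht
      let u : V := e.symm (s • x0, y)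
      let v : V := e.symm (t • x0, z)
      have hu : h (e u).2 ψ < ψ (e u).1 := by simpa [u, hx0] using hs
      have hv : h (e v).2 ψ < ψ (e v).1 := by simpa [v, hx0] using ht
      have su := hsign u hu
      have sv := hsign v hv
      have huv := hadd _ ((hchar u).2 (Or.inl hu)) _ ((hchar v).2 (Or.inl hv)) (by
        have h1 := mul_pos su sv
        have h2 : 0 < φ (T.mkQ p) * φ (T.mkQ p) := mul_self_pos.2 hp0
        by_contra hle
        nlinarith)
      rw [← map_add] at huv
      rcases (hchar _).1 huv with h1 | h1
      · simpa [u, v, hx0] using h1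
      · exfalso
        have h2 : h (e (-(u + v))).2 ψ < ψ (e (-(u + v))).1 := by
          rw [map_neg, Prod.snd_neg, Prod.fst_neg, hneg, map_neg]
          exact h1
        have h3 := hsign _ h2
        rw [map_neg, map_neg, map_add, map_add] at h3
        linarith
    refine le_of_forall_pos_le_add fun ε hε => ?_
    have := key (h y ψ + ε / 2) (h z ψ + ε / 2) (by linarith) (by linarith)
    linarith
  refine ⟨h, ⟨hhl, hhr, hal, har, hneg⟩, ?_⟩
  intro v hv
  by_cases hy : (e v).2 = 0
  · constructor
    · intro hvA
      exact absurd hy (H1' v hvA)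
    · intro H
      exfalso
      have : (e v).1 = 0 := dual_eq_zero fun ψ => (H ψ).trans_eq (by rw [hy, h0])
      exact hv (e.injective (by rw [map_zero]; exact Prod.ext this hy))
  · rw [← hKv]
    constructor
    · intro hx ψ
      exact (hgr _ hy ψ).2 _ hx
    · intro H
      by_contra hx
      obtain ⟨f, c, hf1, hf2⟩ := geometric_hahn_banach_closed_point (Kconv _ hy) (Kclosed _ hy) hx
      obtain ⟨x, hx, hx'⟩ := (hgr _ hy f.toLinearMap).1
      have h1 := H f.toLinearMap
      rw [← hx'] at h1
      have h2 := hf1 x hx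
      simp only [ContinuousLinearMap.coe_coe] at h1
      linarith

end Main

/-- If `A ⊆ ℝPⁿ` is `L`-convex-concave, then `A^⊥_L` is an
`L*`-convex-concave subset of `(ℝPⁿ)*`, and `(A^⊥_L)^⊥_{L*} = A` (viewing the double
`L`-dual in `ℝPⁿ` via the canonical identification `V ≅ V**`). -/
theorem statement10 (n : ℕ) (W : Submodule ℝ (Vec n)) (hW : W ≠ ⊥) (A : Set (Pt n))
    (hA : IsLConvexConcave W A) :
    IsLConvexConcave W.dualAnnihilator (LdualSet W A) ∧ Lbidual W A = A := by
  obtain ⟨C, hC⟩ := W.exists_isCompl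
  let e : Vec n ≃ₗ[ℝ] W × C := (Submodule.prodEquivOfIsCompl W C hC).symm
  have he : ∀ v, v ∈ W ↔ (e v).2 = 0 := fun v =>
    (Submodule.prodEquivOfIsCompl_symm_apply_snd_eq_zero W C hC).symm
  obtain ⟨h, hb, hD⟩ := exists_describes he hA
  refine ⟨?_, bidual_eq he hb hD⟩
  let b := (Module.finBasis ℝ (Module.Dual ℝ (Vec n))).equivFun
  have hind : Topology.IsInducing b := ⟨rfl⟩
  haveI : IsTopologicalAddGroup (Module.Dual ℝ (Vec n)) := hind.topologicalAddGroup b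
  haveI : ContinuousSMul ℝ (Module.Dual ℝ (Vec n)) :=
    hind.continuousSMul continuous_id (fun {c x} => map_smul b c x)
  haveI : T2Space (Module.Dual ℝ (Vec n)) :=
    T2Space.of_injective_continuous b.injective hind.continuous
  exact (hD.dual he hb).isLConvexConcave (dualAnnihilator_char he) hb.dualFun

end CC
end
end

section
/- Let A ⊆ ℝP^n be an L-convex-concave set, where L ⊆ ℝP^n is a projective subspace. If the L-dual set A^⊥_L contains a projective subspace M' of (ℝP^n)* with dim M' = dim L, then A contains the dual projective subspace (M')* ⊆ ℝP^n, which has dimension n − dim L − 1. -/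
open Module Set Pointwise

noncomputable section

namespace CC

variable {M : Type*} [AddCommGroup M] [Module ℝ M]

theorem surj_of_inj_aux {X Y : Type*} [AddCommGroup X] [Module ℝ X] [FiniteDimensional ℝ X]
    [AddCommGroup Y] [Module ℝ Y] [FiniteDimensional ℝ Y] (f : X →ₗ[ℝ] Y)
    (h : finrank ℝ X = finrank ℝ Y) (hf : Function.Injective f) : Function.Surjective f :=
  (LinearMap.injective_iff_surjective_of_finrank_eq_finrank h).mp hf

theorem rep_mk_smul_aux {V : Type*} [AddCommGroup V] [Module ℝ V] (v : V) (hv : v ≠ 0) :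
    ∃ a : ℝ, a ≠ 0 ∧ (Projectivization.mk ℝ v hv).rep = a • v := by
  obtain ⟨a, ha⟩ := Projectivization.exists_smul_eq_mk_rep ℝ v hv
  exact ⟨a, a.ne_zero, ha.symm⟩

theorem chart_image_eq (n : ℕ) (A : Set (Pt n)) (N : Submodule ℝ (Vec n))
    (φ : Module.Dual ℝ (Vec n)) (hφ : ∀ x ∈ A ∩ projSet N, φ x.rep ≠ 0) :
    projChart φ '' (A ∩ projSet N) =
      {v | φ v = 1 ∧ v ∈ N ∧ ∃ h : v ≠ 0, Projectivization.mk ℝ v h ∈ A} := by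
  ext v
  constructor
  · rintro ⟨x, hx, rfl⟩
    have h0 := hφ x hx
    have hne : projChart φ x ≠ 0 := smul_ne_zero (inv_ne_zero h0) x.rep_nonzero
    refine ⟨by simp [projChart, h0], N.smul_mem _ hx.2, hne, ?_⟩
    have : Projectivization.mk ℝ (projChart φ x) hne = x := by
      conv_rhs => rw [← x.mk_rep]
      rw [Projectivization.mk_eq_mk_iff']
      exact ⟨_, rfl⟩
    rw [this]
    exact hx.1
  · rintro ⟨h1, hN, h, hA⟩
    obtain ⟨a, ha, hr⟩ := rep_mk_smul_aux v h
    refine ⟨_, ⟨hA, ?_⟩, ?_⟩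
    · show _ ∈ N
      rw [hr]
      exact N.smul_mem _ hN
    · simp only [projChart, hr, map_smul, h1, smul_eq_mul, mul_one, smul_smul]
      rw [inv_mul_cancel₀ ha, one_smul]

theorem chart_image_closed (n : ℕ) (A : Set (Pt n)) (hA : IsClosed A) (N : Submodule ℝ (Vec n))
    (φ : Module.Dual ℝ (Vec n)) (hφ : ∀ x ∈ A ∩ projSet N, φ x.rep ≠ 0) :
    IsClosed (projChart φ '' (A ∩ projSet N)) := by
  rw [chart_image_eq n A N φ hφ]
  have hc : Continuous (fun v : {v : Vec n // v ≠ 0} => (Projectivization.mk ℝ v.1 v.2 : Pt n)) :=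
    continuous_quotient_mk'
  obtain ⟨K, hK, hKe⟩ := isClosed_induced_iff.mp (hA.preimage hc)
  have : {v | φ v = 1 ∧ v ∈ N ∧ ∃ h : v ≠ 0, (Projectivization.mk ℝ v h : Pt n) ∈ A} =
      {v | φ v = 1} ∩ ((N : Set (Vec n)) ∩ K) := by
    ext v
    constructor
    · rintro ⟨h1, h2, h, h3⟩
      refine ⟨h1, h2, ?_⟩
      have : (⟨v, h⟩ : {v : Vec n // v ≠ 0}) ∈ Subtype.val ⁻¹' K := by
        rw [hKe]; exact h3
      exact this
    · rintro ⟨h1, h2, h3⟩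
      have h : v ≠ 0 := by
        rintro rfl
        simp at h1
      refine ⟨h1, h2, h, ?_⟩
      have : (⟨v, h⟩ : {v : Vec n // v ≠ 0}) ∈ Subtype.val ⁻¹' K := h3
      rw [hKe] at this
      exact this
  rw [this]
  exact (isClosed_eq φ.continuous_of_finiteDimensional continuous_const).inter
    (N.closed_of_finiteDimensional.inter hK)

/-- A functional vanishing at `x ∉ A` and nowhere zero on the section `A ∩ N`. -/
theorem exists_sep (n : ℕ) (A : Set (Pt n)) (hA : IsClosed A) (N : Submodule ℝ (Vec n))
    (hN : IsProjConvex (A ∩ projSet N)) (x : Pt n) (hx : x ∉ A) :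
    ∃ g : Module.Dual ℝ (Vec n), g x.rep = 0 ∧ ∀ y ∈ A ∩ projSet N, g y.rep ≠ 0 := by
  obtain ⟨φ, -, hφ, hconv⟩ := hN
  by_cases h0 : φ x.rep = 0
  · exact ⟨φ, h0, hφ⟩
  have hcl := chart_image_closed n A hA N φ hφ
  have hnot : projChart φ x ∉ projChart φ '' (A ∩ projSet N) := by
    rw [chart_image_eq n A N φ hφ]
    rintro ⟨-, -, h, h3⟩
    have : Projectivization.mk ℝ (projChart φ x) h = x := by
      conv_rhs => rw [← x.mk_rep]
      rw [Projectivization.mk_eq_mk_iff']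
      exact ⟨_, rfl⟩
    rw [this] at h3
    exact hx h3
  obtain ⟨f, u, hfu, hu⟩ := geometric_hahn_banach_point_closed hconv hcl hnot
  refine ⟨f.toLinearMap - f (projChart φ x) • φ, ?_, ?_⟩
  · simp [projChart]
    field_simp
    simp
  · intro y hy h
    have h1 := hφ y hy
    have h2 := hu _ (mem_image_of_mem _ hy)
    have h3 : f (projChart φ y) = (φ y.rep)⁻¹ * f y.rep := by simp [projChart]
    have h4 : f y.rep = f (projChart φ x) * φ y.rep := by
      simpa [sub_eq_zero] using h
    rw [h3, h4, mul_comm, mul_assoc, mul_inv_cancel₀ h1, mul_one] at h2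
    linarith

/-- If `A ⊆ ℝPⁿ` is `L`-convex-concave and the `L`-dual `A^⊥_L`
contains a projective subspace `M' = ℙ(Msub)` of `(ℝPⁿ)*` with `dim M' = dim L`, then
`A` contains the dual subspace `(M')* = ℙ(Msub.dualCoannihilator)`, which has
dimension `n − dim L − 1`. -/
theorem statement11 (n : ℕ) (W : Submodule ℝ (Vec n)) (hW : W ≠ ⊥) (A : Set (Pt n))
    (hA : IsLConvexConcave W A)
    (Msub : Submodule ℝ (Module.Dual ℝ (Vec n))) (hM : Msub ≠ ⊥)
    (hMdim : finrank ℝ Msub = finrank ℝ W)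
    (hMsub : projSet Msub ⊆ LdualSet W A) :
    projSet Msub.dualCoannihilator ⊆ A ∧
    finrank ℝ Msub.dualCoannihilator = n + 1 - finrank ℝ W := by
  obtain ⟨hcl, hdis, hsec, -⟩ := hA
  have key : ∀ m ∈ Msub, m ≠ 0 → ∀ N : Submodule ℝ (Vec n), W ≤ N →
      finrank ℝ N = finrank ℝ W + 1 → ∃ x ∈ A, m x.rep = 0 ∧ x.rep ∈ N := by
    intro m hm hm0 N hWN hN
    obtain ⟨a, ha, hr⟩ := rep_mk_smul_aux m hm0
    have hmem : Projectivization.mk ℝ m hm0 ∈ projSet Msub := by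
      show _ ∈ Msub
      rw [hr]
      exact Msub.smul_mem _ hm
    obtain ⟨x, hxA, hx, hxN⟩ := hMsub hmem N hWN hN
    refine ⟨x, hxA, ?_, hxN⟩
    unfold Incident at hx
    rw [hr] at hx
    simpa [ha] using hx
  have hdim : ∀ v ∉ W, finrank ℝ (W ⊔ Submodule.span ℝ {v} : Submodule ℝ (Vec n)) =
      finrank ℝ W + 1 := by
    intro v hv
    have hv0 : v ≠ 0 := fun h => hv (h ▸ W.zero_mem)
    have h1 := Submodule.finrank_sup_add_finrank_inf_eq W (Submodule.span ℝ {v})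
    have h2 : W ⊓ Submodule.span ℝ {v} = ⊥ :=
      disjoint_iff.mp ((Submodule.disjoint_span_singleton' hv0).mpr hv)
    rw [h2, finrank_bot, finrank_span_singleton hv0] at h1
    simpa using h1
  -- no nonzero functional of `Msub` vanishes on `W`
  have hinj : ∀ m ∈ Msub, (∀ w ∈ W, m w = 0) → m = 0 := by
    intro m hm hmW
    by_contra hm0
    obtain ⟨v, hv⟩ : ∃ v, m v ≠ 0 := by
      by_contra! h
      exact hm0 (LinearMap.ext h)
    have hvW : v ∉ W := fun h => hv (hmW v h)
    obtain ⟨x, hxA, hx, hxN⟩ := key m hm hm0 _ le_sup_left (hdim v hvW)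
    obtain ⟨w, hw, z, hz, hwz⟩ := Submodule.mem_sup.mp hxN
    obtain ⟨c, rfl⟩ := Submodule.mem_span_singleton.mp hz
    rw [← hwz, map_add, hmW w hw, zero_add, map_smul, smul_eq_mul, mul_eq_zero] at hx
    have hc := hx.resolve_right hv
    apply hdis x hxA
    rw [← hwz, hc]
    simpa using hw
  let r : Msub →ₗ[ℝ] (W →ₗ[ℝ] ℝ) := W.subtype.dualMap ∘ₗ Msub.subtype
  have hr : Function.Injective r := by
    rintro ⟨m, hm⟩ ⟨mm, hmm⟩ h
    refine Subtype.ext (sub_eq_zero.mp (hinj _ (Msub.sub_mem hm hmm) fun w hw => ?_))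
    have h1 : m w = mm w := LinearMap.congr_fun h ⟨w, hw⟩
    rw [LinearMap.sub_apply, h1, sub_self]
  have hfr : finrank ℝ Msub = finrank ℝ (W →ₗ[ℝ] ℝ) := by
    rw [hMdim]
    exact Subspace.dual_finrank_eq.symm
  have hrs : Function.Surjective r := by
    have h1 := surj_of_inj_aux (X := Msub) (Y := W →ₗ[ℝ] ℝ) r
    exact h1 hfr hr
  have hann : ∀ v ∈ Msub.dualCoannihilator, ∀ m ∈ Msub, m v = 0 := fun v hv m hm =>
    (Submodule.mem_dualCoannihilator _).mp hv m hm
  constructor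
  · intro x hx
    by_contra hxA
    have hxW : x.rep ∉ W := by
      intro hxW
      apply x.rep_nonzero
      rw [← Module.forall_dual_apply_eq_zero_iff ℝ]
      intro f
      obtain ⟨⟨m, hm⟩, hmf⟩ := hrs (f ∘ₗ W.subtype)
      have h1 := LinearMap.congr_fun hmf ⟨x.rep, hxW⟩
      have h2 : m x.rep = f x.rep := h1
      rw [← h2]
      exact hann _ hx m hm
    have hN := hdim _ hxW
    obtain ⟨⟨y, hy⟩, hconv⟩ := hsec _ le_sup_left hN
    obtain ⟨g, hgx, hg⟩ := exists_sep n A hcl _ hconv x hxA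
    obtain ⟨⟨m, hm⟩, hmf⟩ := hrs (g ∘ₗ W.subtype)
    have hmg : ∀ v ∈ W ⊔ Submodule.span ℝ {x.rep}, m v = g v := by
      intro v hv
      obtain ⟨w, hw, z, hz, rfl⟩ := Submodule.mem_sup.mp hv
      obtain ⟨c, rfl⟩ := Submodule.mem_span_singleton.mp hz
      have h2 : m w = g w := LinearMap.congr_fun hmf ⟨w, hw⟩
      rw [map_add, map_add, map_smul, map_smul, hgx, hann _ hx m hm, h2]
    have hm0 : m ≠ 0 := by
      rintro rfl
      exact hg y hy (by rw [← hmg _ hy.2]; rfl)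
    obtain ⟨z, hzA, hz, hzN⟩ := key m hm hm0 _ le_sup_left hN
    exact hg z ⟨hzA, hzN⟩ (by rw [← hmg _ hzN]; exact hz)
  · have h := Subspace.finrank_add_finrank_dualCoannihilator_eq Msub
    rw [hMdim, finrank_fin_fun] at h
    omega

end CC
end
end

section
/- Let N ⊆ ℝ^n be a linear subspace, π : ℝ^n → ℝ^n/N the quotient map, Δ ⊆ ℝ^n/N a convex set, and for each m ∈ Δ let A_m ⊆ π^{-1}(m) be a nonempty compact convex set. Then the following are equivalent: (i) for all m₁, m₂ ∈ Δ and all t ∈ [0,1], A_{t m₁ + (1−t) m₂} = t • A_{m₁} + (1−t) • A_{m₂}; (ii) for every linear subspace Q ⊆ N with dim Q = dim N − 1, denoting by q : ℝ^n → ℝ^n/Q the quotient map, for all m₁, m₂ ∈ Δ and all t ∈ [0,1], q(A_{t m₁ + (1−t) m₂}) = t • q(A_{m₁}) + (1−t) • q(A_{m₂}). -/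
open Module Set Pointwise

noncomputable section

namespace CC

variable {M : Type*} [AddCommGroup M] [Module ℝ M]

/-- A set of a fibre of `N` is contained in a closed convex set of the same fibre as soon as this
holds after projecting along every hyperplane of `N`. -/
theorem subset_of_proj {k : ℕ} (N : Submodule ℝ (Fin k → ℝ)) (B C : Set (Fin k → ℝ))
    (hBC : ∀ x ∈ B, ∀ y ∈ C, x - y ∈ N) (hne : C.Nonempty) (hcl : IsClosed C)
    (hconv : Convex ℝ C)
    (h : ∀ Q : Submodule ℝ (Fin k → ℝ), Q ≤ N → finrank ℝ Q + 1 = finrank ℝ N →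
      Q.mkQ '' B ⊆ Q.mkQ '' C) : B ⊆ C := by
  intro x hx
  by_contra hxC
  obtain ⟨f, u, hfu, hux⟩ := geometric_hahn_banach_closed_point hconv hcl hxC
  by_cases h0 : (f : (Fin k → ℝ) →ₗ[ℝ] ℝ).domRestrict N = 0
  · obtain ⟨c, hc⟩ := hne
    have h1 : f (x - c) = 0 := by
      have := LinearMap.congr_fun h0 ⟨x - c, hBC x hx c hc⟩
      simpa using this
    rw [map_sub] at h1
    have := hfu c hc
    linarith
  · have hr := Module.Dual.finrank_ker_add_one_of_ne_zero h0
    let K : Submodule ℝ N := LinearMap.ker ((f : (Fin k → ℝ) →ₗ[ℝ] ℝ).domRestrict N)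
    have hfr : finrank ℝ (K.map N.subtype) = finrank ℝ K :=
      Submodule.finrank_map_subtype_eq N K
    obtain ⟨c, hc, hcx⟩ := h (K.map N.subtype) (Submodule.map_subtype_le N K)
      (by rw [hfr]; exact hr) ⟨x, hx, rfl⟩
    have h2 : c - x ∈ K.map N.subtype := (Submodule.Quotient.eq _).1 hcx
    obtain ⟨y, hy, hyx⟩ := h2
    have h3 : f (c - x) = 0 := by
      rw [← hyx]
      exact hy
    rw [map_sub] at h3
    have := hfu c hc
    linarith

/-- For a family of nonempty compact convex sets `A m ⊆ π⁻¹(m)`,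
`m ∈ Δ`, in `ℝᵏ` fibered over `ℝᵏ/N`, affine dependence on the parameter (Minkowski
linearity along segments of `Δ`) is equivalent to affine dependence in the direction
of every hyperplane `Q` of `N` (Minkowski linearity of the projections to `ℝᵏ/Q`). -/
theorem statement12 (k : ℕ) (N : Submodule ℝ (Fin k → ℝ))
    (Δ : Set ((Fin k → ℝ) ⧸ N)) (hΔ : Convex ℝ Δ)
    (A : ((Fin k → ℝ) ⧸ N) → Set (Fin k → ℝ))
    (hfiber : ∀ m ∈ Δ, ∀ x ∈ A m, N.mkQ x = m)
    (hne : ∀ m ∈ Δ, (A m).Nonempty)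
    (hcpt : ∀ m ∈ Δ, IsCompact (A m))
    (hconv : ∀ m ∈ Δ, Convex ℝ (A m)) :
    ((∀ m₁ ∈ Δ, ∀ m₂ ∈ Δ, ∀ t ∈ Icc (0 : ℝ) 1,
        A (t • m₁ + (1 - t) • m₂) = t • A m₁ + (1 - t) • A m₂) ↔
      (∀ Q : Submodule ℝ (Fin k → ℝ), Q ≤ N → finrank ℝ Q + 1 = finrank ℝ N →
        ∀ m₁ ∈ Δ, ∀ m₂ ∈ Δ, ∀ t ∈ Icc (0 : ℝ) 1,
          Q.mkQ '' A (t • m₁ + (1 - t) • m₂) =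
            t • (Q.mkQ '' A m₁) + (1 - t) • (Q.mkQ '' A m₂))) := by
  have key : ∀ (Q : Submodule ℝ (Fin k → ℝ)) (S T : Set (Fin k → ℝ)) (t : ℝ),
      Q.mkQ '' (t • S + (1 - t) • T) = t • (Q.mkQ '' S) + (1 - t) • (Q.mkQ '' T) := by
    intro Q S T t
    rw [Set.image_add, image_smul_set, image_smul_set]
  constructor
  · intro h Q _ _ m₁ h₁ m₂ h₂ t ht
    rw [h m₁ h₁ m₂ h₂ t ht, key]
  · intro h m₁ h₁ m₂ h₂ t ht
    have hm : t • m₁ + (1 - t) • m₂ ∈ Δ :=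
      hΔ h₁ h₂ ht.1 (sub_nonneg.2 ht.2) (by ring)
    have hD : ∀ y ∈ t • A m₁ + (1 - t) • A m₂, N.mkQ y = t • m₁ + (1 - t) • m₂ := by
      rintro y ⟨_, ⟨a, ha, rfl⟩, _, ⟨b, hb, rfl⟩, rfl⟩
      simp only [map_add, map_smul, hfiber m₁ h₁ a ha, hfiber m₂ h₂ b hb]
    have hDne : (t • A m₁ + (1 - t) • A m₂).Nonempty :=
      ((hne m₁ h₁).smul_set).add ((hne m₂ h₂).smul_set)
    have hDc : IsCompact (t • A m₁ + (1 - t) • A m₂) :=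
      ((hcpt m₁ h₁).smul t).add ((hcpt m₂ h₂).smul (1 - t))
    have hDv : Convex ℝ (t • A m₁ + (1 - t) • A m₂) :=
      ((hconv m₁ h₁).smul t).add ((hconv m₂ h₂).smul (1 - t))
    apply Set.Subset.antisymm
    · refine subset_of_proj N _ _ ?_ hDne hDc.isClosed hDv ?_
      · intro x hx y hy
        exact (Submodule.Quotient.eq N).1 ((hfiber _ hm x hx).trans (hD y hy).symm)
      · intro Q hQ hf
        rw [key, h Q hQ hf m₁ h₁ m₂ h₂ t ht]
    · refine subset_of_proj N _ _ ?_ (hne _ hm) (hcpt _ hm).isClosed (hconv _ hm) ?_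
      · intro x hx y hy
        exact (Submodule.Quotient.eq N).1 ((hD x hx).trans (hfiber _ hm y hy).symm)
      · intro Q hQ hf
        rw [key, h Q hQ hf m₁ h₁ m₂ h₂ t ht]

end CC
end
end
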